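/- There are infinitely many positive integers n such that π(n) = n/⌊log n − 1⌋, i.e., such that ⌊log n − 1⌋ is positive, divides n, and n/⌊log n − 1⌋ equals π(n). -/

import Mathlib

section ZeroFreeRegion

open Complex Filter Topology

/-- `(s - 1) n⁻ˢ - ∫ x in n..n+1, (s - 1) x⁻ˢ` in closed form. -/
noncomputable def zetaDiffTerm (n : ℕ) (s : ℂ) : ℂ :=
  (s - 1) * (n : ℂ) ^ (-s) + ((n + 1 : ℕ) : ℂ) ^ (1 - s) - (n : ℂ) ^ (1 - s)

lemma hasDerivAt_ofReal_cpow_neg {x : ℝ} (hx : 0 < x) (r : ℂ) :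
    HasDerivAt (fun y : ℝ ↦ (y : ℂ) ^ r) (r * (x : ℂ) ^ (r - 1)) x := by
  have h := (hasDerivAt_id (x : ℂ)).cpow_const (c := r) (Or.inl (by simpa using hx))
  simpa using h.comp_ofReal

lemma norm_cpow_sub_cpow_le {n x : ℝ} (hn : 0 < n) (hx : n ≤ x) (hx' : x ≤ n + 1) {s : ℂ}
    (hs : 0 ≤ s.re) :
    ‖(x : ℂ) ^ (-s) - (n : ℂ) ^ (-s)‖ ≤ ‖s‖ * n ^ (-s.re - 1) := by
  have h := (convex_Icc n (n + 1)).norm_image_sub_le_of_norm_hasDerivWithin_le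
    (f := fun y : ℝ ↦ (y : ℂ) ^ (-s)) (f' := fun y : ℝ ↦ -s * (y : ℂ) ^ (-s - 1))
    (C := ‖s‖ * n ^ (-s.re - 1)) (x := n) (y := x)
    (fun y hy ↦ (hasDerivAt_ofReal_cpow_neg (hn.trans_le hy.1) _).hasDerivWithinAt) ?_
    ⟨le_rfl, by linarith⟩ ⟨hx, hx'⟩
  · refine h.trans ?_
    have : ‖x - n‖ ≤ 1 := by
      rw [Real.norm_eq_abs, abs_le]
      constructor <;> linarith
    exact mul_le_of_le_one_right (by positivity) this
  · intro y hy
    have hy0 : 0 < y := hn.trans_le hy.1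
    rw [norm_mul, norm_neg, norm_cpow_eq_rpow_re_of_pos hy0]
    refine mul_le_mul_of_nonneg_left ?_ (norm_nonneg _)
    simpa using Real.rpow_le_rpow_of_nonpos hn hy.1 (by linarith : -s.re - 1 ≤ 0)

lemma norm_cpow_sub_cpow_le' {n x : ℝ} (hn : 0 < n) (hx : n ≤ x) {s : ℂ}
    (hs : 0 ≤ s.re) :
    ‖(x : ℂ) ^ (-s) - (n : ℂ) ^ (-s)‖ ≤ 2 * n ^ (-s.re) := by
  refine (norm_sub_le _ _).trans ?_
  rw [norm_cpow_eq_rpow_re_of_pos hn, norm_cpow_eq_rpow_re_of_pos (hn.trans_le hx), neg_re]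
  have := Real.rpow_le_rpow_of_nonpos hn hx (by linarith : -s.re ≤ 0)
  linarith

lemma norm_zetaDiffTerm_le_mul {n : ℕ} (hn : 0 < n) {s : ℂ} {M : ℝ}
    (hM : ∀ x : ℝ, n ≤ x → x ≤ n + 1 → ‖(x : ℂ) ^ (-s) - (n : ℂ) ^ (-s)‖ ≤ M) :
    ‖zetaDiffTerm n s‖ ≤ ‖s - 1‖ * M := by
  have hn' : (0 : ℝ) < n := by exact_mod_cast hn
  have h := (convex_Icc (n : ℝ) (n + 1)).norm_image_sub_le_of_norm_hasDerivWithin_le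
    (f := fun y : ℝ ↦ (y : ℂ) ^ (1 - s) + (s - 1) * (n : ℂ) ^ (-s) * (y : ℂ))
    (f' := fun y : ℝ ↦ (1 - s) * (y : ℂ) ^ (1 - s - 1) + (s - 1) * (n : ℂ) ^ (-s) * 1)
    (C := ‖s - 1‖ * M) (x := n) (y := n + 1) ?_ ?_ ⟨le_rfl, by linarith⟩ ⟨by linarith, le_rfl⟩
  · convert h using 1
    · rw [zetaDiffTerm]
      push_cast
      congr 1
      ring
    · simp
  · intro y hy
    exact ((hasDerivAt_ofReal_cpow_neg (hn'.trans_le hy.1) _).add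
      ((hasDerivAt_id (y : ℂ)).comp_ofReal.const_mul _)).hasDerivWithinAt
  · intro y hy
    have : (1 - s) * (y : ℂ) ^ (1 - s - 1) + (s - 1) * (n : ℂ) ^ (-s) * 1
        = -((s - 1) * ((y : ℂ) ^ (-s) - (n : ℂ) ^ (-s))) := by
      rw [show 1 - s - 1 = -s by ring]; ring
    rw [this, norm_neg, norm_mul]
    exact mul_le_mul_of_nonneg_left (hM y hy.1 hy.2) (norm_nonneg _)

lemma le_rpow_mul_rpow_of_le {M a b θ : ℝ} (hM : 0 ≤ M) (ha : M ≤ a) (hb : M ≤ b)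
    (h0 : 0 ≤ θ) (h1 : θ ≤ 1) : M ≤ a ^ θ * b ^ (1 - θ) := by
  calc M = M ^ θ * M ^ (1 - θ) := by
        rw [← Real.rpow_add_of_nonneg hM h0 (by linarith)]; simp
    _ ≤ _ := by
        have := hM.trans ha
        gcongr

lemma norm_zetaDiffTerm_le {n : ℕ} (hn : 0 < n) {s : ℂ} (hs : 1 - 1 / 200 ≤ s.re) :
    ‖zetaDiffTerm n s‖ ≤ ‖s - 1‖ * (2 * ‖s‖ ^ (1 / 100 : ℝ) * (n : ℝ) ^ (-(201 / 200) : ℝ)) := by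
  refine norm_zetaDiffTerm_le_mul hn fun x hx hx' ↦ ?_
  have hn' : (1 : ℝ) ≤ n := by exact_mod_cast hn
  have hn0 : (0 : ℝ) < n := by linarith
  have hs0 : 0 ≤ s.re := by linarith
  have h1 := norm_cpow_sub_cpow_le hn0 hx hx' hs0
  have h2 := norm_cpow_sub_cpow_le' hn0 hx hs0
  simp only [ofReal_natCast] at h1 h2
  refine (le_rpow_mul_rpow_of_le (norm_nonneg _) h1 h2 (by norm_num : (0 : ℝ) ≤ 1 / 100)
    (by norm_num)).trans ?_
  rw [Real.mul_rpow (norm_nonneg _) (by positivity), Real.mul_rpow (by norm_num) (by positivity),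
    ← Real.rpow_mul hn0.le, ← Real.rpow_mul hn0.le]
  have h3 : (2 : ℝ) ^ (1 - 1 / 100 : ℝ) ≤ 2 := by
    conv_rhs => rw [← Real.rpow_one 2]
    exact Real.rpow_le_rpow_of_exponent_le (by norm_num) (by norm_num)
  have h4 : (n : ℝ) ^ ((-s.re - 1) * (1 / 100)) * (n : ℝ) ^ (-s.re * (1 - 1 / 100))
      ≤ (n : ℝ) ^ (-(201 / 200) : ℝ) := by
    rw [← Real.rpow_add hn0]
    exact Real.rpow_le_rpow_of_exponent_le hn' (by linarith)
  calc _ = (2 : ℝ) ^ (1 - 1 / 100 : ℝ) * ‖s‖ ^ (1 / 100 : ℝ) *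
        ((n : ℝ) ^ ((-s.re - 1) * (1 / 100)) * (n : ℝ) ^ (-s.re * (1 - 1 / 100))) := by ring
    _ ≤ _ := by gcongr

lemma summable_nat_succ_rpow : Summable fun n : ℕ ↦ ((n + 1 : ℕ) : ℝ) ^ (-(201 / 200) : ℝ) :=
  (summable_nat_add_iff 1).2 (Real.summable_nat_rpow.2 (by norm_num))

lemma differentiable_zetaDiffTerm {n : ℕ} (hn : 0 < n) : Differentiable ℂ (zetaDiffTerm n) := by
  have h1 : (n : ℂ) ≠ 0 := by exact_mod_cast hn.ne'
  have h2 : ((n + 1 : ℕ) : ℂ) ≠ 0 := by exact_mod_cast n.succ_ne_zero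
  unfold zetaDiffTerm
  intro s
  refine ((DifferentiableAt.mul (by fun_prop) ?_).add ?_).sub ?_
  · exact DifferentiableAt.const_cpow (by fun_prop) (Or.inl h1)
  · exact DifferentiableAt.const_cpow (by fun_prop) (Or.inl h2)
  · exact DifferentiableAt.const_cpow (by fun_prop) (Or.inl h1)

lemma hasSum_zetaDiffTerm_of_one_lt {s : ℂ} (hs : 1 < s.re) :
    HasSum (fun n : ℕ ↦ zetaDiffTerm (n + 1) s) (riemannZeta₁ s - 1) := by
  have hs1 : s ≠ 1 := by rintro rfl; simp at hs
  have h1 : HasSum (fun n : ℕ ↦ 1 / ((n + 1 : ℕ) : ℂ) ^ s) (riemannZeta s) := by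
    rw [zeta_eq_tsum_one_div_nat_add_one_cpow hs]
    have := (Complex.summable_one_div_nat_cpow (p := s)).2 hs
    simpa using ((summable_nat_add_iff 1).2 this).hasSum
  have h2 : HasSum (fun n : ℕ ↦ ((n + 1 + 1 : ℕ) : ℂ) ^ (1 - s) - ((n + 1 : ℕ) : ℂ) ^ (1 - s))
      (0 - 1) := by
    have ht : Tendsto (fun n : ℕ ↦ ((n + 1 : ℕ) : ℂ) ^ (1 - s)) atTop (𝓝 0) := by
      rw [tendsto_zero_iff_norm_tendsto_zero]
      have h3 : Tendsto (fun n : ℕ ↦ ((n + 1 : ℕ) : ℝ) ^ (-(s.re - 1))) atTop (𝓝 0) :=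
        (tendsto_rpow_neg_atTop (by linarith)).comp
          (tendsto_natCast_atTop_atTop.comp (tendsto_add_atTop_nat 1))
      refine h3.congr fun n ↦ ?_
      rw [norm_natCast_cpow_of_pos n.succ_pos]
      simp
    have hsum : Summable (fun n : ℕ ↦ ((n + 1 + 1 : ℕ) : ℂ) ^ (1 - s)
        - ((n + 1 : ℕ) : ℂ) ^ (1 - s)) := by
      have h5 : Summable fun n : ℕ ↦ zetaDiffTerm (n + 1) s := by
        refine Summable.of_norm_bounded ((summable_nat_succ_rpow.mul_left
          (‖s - 1‖ * (2 * ‖s‖ ^ (1 / 100 : ℝ))))) fun n ↦ ?_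
        refine (norm_zetaDiffTerm_le n.succ_pos (by linarith)).trans (le_of_eq (by ring))
      refine (h5.sub (h1.summable.mul_left (s - 1))).congr fun n ↦ ?_
      simp only [zetaDiffTerm, cpow_neg, one_div]
      ring
    refine (hsum.hasSum_iff_tendsto_nat).2 ?_
    have h6 : ∀ n : ℕ, ∑ i ∈ Finset.range n, (((i + 1 + 1 : ℕ) : ℂ) ^ (1 - s)
        - ((i + 1 : ℕ) : ℂ) ^ (1 - s)) = ((n + 1 : ℕ) : ℂ) ^ (1 - s) - 1 := by
      intro n
      rw [Finset.sum_range_sub (fun i : ℕ ↦ ((i + 1 : ℕ) : ℂ) ^ (1 - s))]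
      simp
    exact (ht.sub_const 1).congr fun n ↦ (h6 n).symm
  have h7 := (h1.mul_left (s - 1)).add h2
  have h8 : (s - 1) * riemannZeta s + (0 - 1) = riemannZeta₁ s - 1 := by
    rw [riemannZeta_eq_inv_sub_mul hs1]
    have : s - 1 ≠ 0 := sub_ne_zero.2 hs1
    field_simp
    ring
  rw [h8] at h7
  have h9 : (fun n : ℕ ↦ zetaDiffTerm (n + 1) s) = fun n : ℕ ↦
      (s - 1) * (1 / ((n + 1 : ℕ) : ℂ) ^ s) +
        (((n + 1 + 1 : ℕ) : ℂ) ^ (1 - s) - ((n + 1 : ℕ) : ℂ) ^ (1 - s)) := by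
    funext n
    simp only [zetaDiffTerm, cpow_neg, one_div]
    ring
  rwa [h9]

lemma riemannZeta₁_sub_one_eq_tsum {s : ℂ} (hs : 1 - 1 / 200 < s.re) :
    riemannZeta₁ s - 1 = ∑' n : ℕ, zetaDiffTerm (n + 1) s := by
  set R : ℝ := ‖s‖ + 3 with hR
  set U : Set ℂ := {z | 1 - 1 / 200 < z.re} ∩ Metric.ball 0 R with hU
  have hR0 : 0 < R := by positivity
  have hUo : IsOpen U := (isOpen_lt continuous_const continuous_re).inter Metric.isOpen_ball
  have hUc : Convex ℝ U := (convex_halfSpace_re_gt _).inter (convex_ball _ _)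
  have hd : DifferentiableOn ℂ (fun z ↦ ∑' n : ℕ, zetaDiffTerm (n + 1) z) U := by
    refine differentiableOn_tsum_of_summable_norm
      (summable_nat_succ_rpow.mul_left ((R + 1) * (2 * R ^ (1 / 100 : ℝ))))
      (fun n ↦ (differentiable_zetaDiffTerm n.succ_pos).differentiableOn) hUo fun n z hz ↦ ?_
    refine (norm_zetaDiffTerm_le n.succ_pos hz.1.le).trans ?_
    have hz2 : ‖z‖ ≤ R := (mem_ball_zero_iff.1 hz.2).le
    have hz3 : ‖z - 1‖ ≤ R + 1 := (norm_sub_le _ _).trans (by simpa using hz2)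
    calc _ ≤ (R + 1) * (2 * R ^ (1 / 100 : ℝ) * ((n + 1 : ℕ) : ℝ) ^ (-(201 / 200) : ℝ)) := by
          gcongr
      _ = _ := by ring
  have hd' : DifferentiableOn ℂ (fun z ↦ riemannZeta₁ z - 1) U :=
    (differentiable_riemannZeta₁.sub_const 1).differentiableOn
  refine (hd'.analyticOnNhd hUo).eqOn_of_preconnected_of_eventuallyEq (hd.analyticOnNhd hUo)
    hUc.isPreconnected (z₀ := 2) ⟨by norm_num, ?_⟩ ?_ ⟨hs, ?_⟩
  · have := norm_nonneg s
    simp [hR]; linarith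
  · filter_upwards [(isOpen_lt continuous_const continuous_re).mem_nhds
      (show (1 : ℝ) < (2 : ℂ).re by norm_num)] with z hz
    exact (hasSum_zetaDiffTerm_of_one_lt hz).tsum_eq.symm
  · simp [hR]

lemma exists_norm_riemannZeta₀_le : ∃ C : ℝ, 0 < C ∧ ∀ s : ℂ, 1 - 1 / 200 < s.re →
    ‖riemannZeta₀ s‖ ≤ C * ‖s‖ ^ (1 / 100 : ℝ) := by
  refine ⟨2 * (∑' n : ℕ, ((n + 1 : ℕ) : ℝ) ^ (-(201 / 200) : ℝ)) + ‖riemannZeta₀ 1‖ + 1, ?_, ?_⟩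
  · have : 0 ≤ ∑' n : ℕ, ((n + 1 : ℕ) : ℝ) ^ (-(201 / 200) : ℝ) :=
      tsum_nonneg fun n ↦ by positivity
    positivity
  intro s hs
  set S := ∑' n : ℕ, ((n + 1 : ℕ) : ℝ) ^ (-(201 / 200) : ℝ) with hS
  have hS0 : 0 ≤ S := tsum_nonneg fun n ↦ by positivity
  rcases eq_or_ne s 1 with rfl | hs1
  · simp only [norm_one, Real.one_rpow, mul_one]
    linarith
  have hs2 : 0 < ‖s - 1‖ := norm_pos_iff.2 (sub_ne_zero.2 hs1)
  have h1 : ‖(s - 1) * riemannZeta₀ s‖ ≤ ‖s - 1‖ * (2 * S * ‖s‖ ^ (1 / 100 : ℝ)) := by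
    have h2 : (s - 1) * riemannZeta₀ s = ∑' n : ℕ, zetaDiffTerm (n + 1) s := by
      rw [← riemannZeta₁_sub_one_eq_tsum hs, riemannZeta₁]
      ring
    rw [h2]
    refine tsum_of_norm_bounded (summable_nat_succ_rpow.hasSum.mul_left
      (‖s - 1‖ * (2 * ‖s‖ ^ (1 / 100 : ℝ)))) (fun n ↦ ?_) |>.trans (le_of_eq ?_)
    · exact (norm_zetaDiffTerm_le n.succ_pos hs.le).trans (le_of_eq (by ring))
    · rw [hS]; ring
  rw [norm_mul] at h1
  refine (le_of_mul_le_mul_left h1 hs2).trans ?_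
  have : 0 ≤ ‖riemannZeta₀ 1‖ := norm_nonneg _
  gcongr
  linarith

lemma exists_norm_riemannZeta₀_le_mul : ∃ C : ℝ, 0 < C ∧ ∀ Y : ℝ, 1 ≤ Y → ∀ s : ℂ,
    1 - 1 / 400 ≤ s.re → s.re ≤ 2 → |s.im| ≤ 2 * Y ^ 100 →
    ‖riemannZeta₀ s‖ ≤ C * Y ∧ ‖deriv riemannZeta₀ s‖ ≤ C * Y := by
  obtain ⟨C, hC, h⟩ := exists_norm_riemannZeta₀_le
  have key : ∀ Y : ℝ, 1 ≤ Y → ∀ s : ℂ, 1 - 1 / 200 < s.re → s.re ≤ 3 →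
      |s.im| ≤ 2 * Y ^ 100 + 1 → ‖riemannZeta₀ s‖ ≤ 6 * C * Y := by
    intro Y hY s h1 h2 h3
    have hY1 : 1 ≤ Y ^ 100 := one_le_pow₀ hY
    have hs : ‖s‖ ≤ 6 * Y ^ 100 := by
      refine (norm_le_abs_re_add_abs_im s).trans ?_
      rw [abs_of_nonneg (by linarith : 0 ≤ s.re)]
      linarith
    calc ‖riemannZeta₀ s‖ ≤ C * ‖s‖ ^ (1 / 100 : ℝ) := h s h1
      _ ≤ C * (6 * Y ^ 100) ^ (1 / 100 : ℝ) := by gcongr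
      _ = C * ((6 : ℝ) ^ (1 / 100 : ℝ) * Y) := by
        rw [Real.mul_rpow (by norm_num) (by positivity), ← Real.rpow_natCast Y 100,
          ← Real.rpow_mul (by linarith)]
        norm_num
      _ ≤ C * (6 * Y) := by
        have : (6 : ℝ) ^ (1 / 100 : ℝ) ≤ 6 := by
          conv_rhs => rw [← Real.rpow_one 6]
          exact Real.rpow_le_rpow_of_exponent_le (by norm_num) (by norm_num)
        gcongr
      _ = _ := by ring
  refine ⟨800 * (6 * C), by positivity, fun Y hY s h1 h2 h3 ↦ ⟨?_, ?_⟩⟩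
  · refine (key Y hY s (by linarith) (by linarith) (by linarith)).trans ?_
    have : 0 ≤ 6 * C * Y := by positivity
    linarith
  · have := norm_deriv_le_of_forall_mem_sphere_norm_le (f := riemannZeta₀) (c := s)
      (C := 6 * C * Y) (R := 1 / 800) (by norm_num)
      differentiable_riemannZeta₀.diffContOnCl fun z hz ↦ ?_
    · refine this.trans (le_of_eq (by ring))
    · have hz' : ‖z - s‖ = 1 / 800 := by simpa using hz
      have hre := abs_le.1 ((abs_re_le_norm (z - s)).trans_eq hz')
      have him := (abs_im_le_norm (z - s)).trans_eq hz'
      rw [sub_re] at hre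
      rw [sub_im] at him
      refine key Y hY z (by linarith) (by linarith) ?_
      have := abs_sub_abs_le_abs_sub z.im s.im
      linarith

lemma norm_riemannZeta_product_ge_one {x : ℝ} (hx : 0 < x) (y : ℝ) :
    1 ≤ ‖riemannZeta (1 + x)‖ ^ 3 * ‖riemannZeta (1 + x + I * y)‖ ^ 4 *
      ‖riemannZeta (1 + x + 2 * I * y)‖ := by
  have h := DirichletCharacter.norm_LFunction_product_ge_one (N := 1) 1 hx y
  simpa [DirichletCharacter.LFunctionTrivChar, DirichletCharacter.LFunction_modOne_eq] using h

lemma one_le_norm_sub_one {s : ℂ} (h : 1 ≤ |s.im|) : 1 ≤ ‖s - 1‖ := by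
  have := abs_im_le_norm (s - 1)
  simp at this
  linarith

lemma exists_le_norm_riemannZeta : ∃ κ : ℝ, 0 < κ ∧ κ ≤ 1 / 400 ∧ ∀ Y : ℝ, 1 ≤ Y → ∀ s : ℂ,
    1 - κ / Y ^ 5 ≤ s.re → s.re ≤ 2 → 1 ≤ |s.im| → |s.im| ≤ Y ^ 100 →
    κ / Y ^ 4 ≤ ‖riemannZeta s‖ := by
  obtain ⟨C, hC, h⟩ := exists_norm_riemannZeta₀_le_mul
  set D : ℝ := C + 400 with hD
  have hD1 : 400 ≤ D := by linarith
  have upper : ∀ Y : ℝ, 1 ≤ Y → ∀ s : ℂ, 1 - 1 / 400 ≤ s.re → s.re ≤ 2 → 1 ≤ |s.im| →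
      |s.im| ≤ 2 * Y ^ 100 → ‖riemannZeta s‖ ≤ D * Y ∧ ‖deriv riemannZeta s‖ ≤ D * Y := by
    intro Y hY s h1 h2 h3 h4
    have hs := one_le_norm_sub_one h3
    have hs1 : s ≠ 1 := by rintro rfl; norm_num at hs
    have hi : ‖(s - 1)⁻¹‖ ≤ 1 := by rw [norm_inv]; exact inv_le_one_of_one_le₀ hs
    obtain ⟨h5, h6⟩ := h Y hY s h1 h2 h4
    constructor
    · rw [riemannZeta_eq_inv_sub_add hs1]
      refine (norm_add_le _ _).trans ?_
      nlinarith
    · rw [deriv_riemannZeta_eq_neg_inv_sub_sq_add hs1]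
      refine (norm_add_le _ _).trans ?_
      rw [norm_neg, norm_pow]
      have : ‖(s - 1)⁻¹‖ ^ 2 ≤ 1 := pow_le_one₀ (norm_nonneg _) hi
      nlinarith
  have lower : ∀ Y : ℝ, 1 ≤ Y → ∀ s : ℂ, 1 < s.re → s.re ≤ 2 → 1 ≤ |s.im| → |s.im| ≤ Y ^ 100 →
      (s.re - 1) ^ 3 ≤ D ^ 4 * Y * ‖riemannZeta s‖ ^ 4 := by
    intro Y hY s h1 h2 h3 h4
    set x := s.re - 1 with hx
    have hx0 : 0 < x := by linarith
    have hp := norm_riemannZeta_product_ge_one hx0 s.im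
    have e1 : (1 + x + I * s.im : ℂ) = s := by
      apply Complex.ext <;> simp [hx]
    have e2 : ‖riemannZeta (1 + x)‖ ≤ D / x := by
      have hne : (1 + x : ℂ) ≠ 1 := by simpa using hx0.ne'
      rw [riemannZeta_eq_inv_sub_add hne]
      refine (norm_add_le _ _).trans ?_
      have := (h 1 le_rfl (1 + x) (by simp; linarith) (by simp; linarith) (by simp)).1
      have hi : ‖(1 + x - 1 : ℂ)⁻¹‖ = 1 / x := by
        simp [abs_of_pos hx0]
      rw [hi, hD, add_div]
      have h7 : C ≤ C / x := by rw [le_div_iff₀ hx0]; nlinarith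
      have h8 : 1 / x ≤ 400 / x := by gcongr; norm_num
      linarith
    have e3 : ‖riemannZeta (1 + x + 2 * I * s.im)‖ ≤ D * Y := by
      refine (upper Y hY _ ?_ ?_ ?_ ?_).1
      · simp; linarith
      · simp; linarith
      · simp [abs_mul]; linarith
      · simp [abs_mul]; linarith
    rw [e1] at hp
    have : 1 ≤ (D / x) ^ 3 * ‖riemannZeta s‖ ^ 4 * (D * Y) := by
      refine hp.trans ?_
      gcongr
    calc x ^ 3 = x ^ 3 * 1 := by ring
      _ ≤ x ^ 3 * ((D / x) ^ 3 * ‖riemannZeta s‖ ^ 4 * (D * Y)) := by gcongr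
      _ = _ := by field_simp
  have hDpos : 0 < D := by linarith
  set m : ℝ := 2 * D + 1 with hm
  have hm0 : 0 < m := by linarith
  set κ : ℝ := 1 / (m ^ 4 * D ^ 4) with hκ
  have hκ0 : 0 < κ := by positivity
  have hκ1 : κ ≤ 1 / 400 := by
    rw [hκ]
    refine one_div_le_one_div_of_le (by norm_num) ?_
    have h1 : 1 ≤ m ^ 4 := one_le_pow₀ (by linarith)
    have h2 : D ≤ D ^ 4 := le_self_pow₀ (by linarith) (by norm_num)
    nlinarith
  refine ⟨κ, hκ0, hκ1, fun Y hY s h1 h2 h3 h4 ↦ ?_⟩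
  have hY0 : 0 < Y := by linarith
  set x := κ / Y ^ 5 with hx
  have hx0 : 0 < x := by positivity
  have hx1 : x ≤ 1 / 400 := (div_le_self hκ0.le (one_le_pow₀ hY)).trans hκ1
  have right : ∀ z : ℂ, 1 + x ≤ z.re → z.re ≤ 2 → 1 ≤ |z.im| → |z.im| ≤ Y ^ 100 →
      m * κ / Y ^ 4 ≤ ‖riemannZeta z‖ := by
    intro z g1 g2 g3 g4
    have g5 := lower Y hY z (by linarith) g2 g3 g4
    have g6 : x ^ 3 ≤ D ^ 4 * Y * ‖riemannZeta z‖ ^ 4 :=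
      (pow_le_pow_left₀ hx0.le (by linarith) 3).trans g5
    refine le_of_pow_le_pow_left₀ (n := 4) (by norm_num) (norm_nonneg _) ?_
    have g7 : (m * κ / Y ^ 4) ^ 4 = x ^ 3 / (D ^ 4 * Y) := by
      rw [hx, hκ]; field_simp
    rw [g7, div_le_iff₀ (by positivity)]
    linarith
  rcases le_total (1 + x) s.re with hs | hs
  · refine le_trans ?_ (right s hs h2 h3 h4)
    gcongr
    nlinarith
  · set w : ℂ := ⟨1 + x, s.im⟩ with hw
    have g1 := right w le_rfl (by simp [hw]; linarith) h3 h4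
    set S : Set ℂ := Set.Icc (1 - x) (1 + x) ×ℂ {s.im} with hS
    have hconv : Convex ℝ S := ((convex_Icc _ _).linear_preimage reLm).inter
      ((convex_singleton _).linear_preimage imLm)
    have hmem : ∀ z ∈ S, 1 - x ≤ z.re ∧ z.re ≤ 1 + x ∧ z.im = s.im := by
      intro z hz
      simp only [hS, mem_reProdIm, Set.mem_Icc, Set.mem_singleton_iff] at hz
      tauto
    have g2 : ‖riemannZeta w - riemannZeta s‖ ≤ D * Y * ‖w - s‖ := by
      refine hconv.norm_image_sub_le_of_norm_deriv_le (fun z hz ↦ ?_) (fun z hz ↦ ?_) ?_ ?_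
      · refine differentiableAt_riemannZeta ?_
        have := one_le_norm_sub_one (s := z) (by rw [(hmem z hz).2.2]; exact h3)
        rintro rfl
        norm_num at this
      · obtain ⟨k1, k2, k3⟩ := hmem z hz
        refine (upper Y hY z (by linarith) (by linarith) (by rwa [k3]) ?_).2
        rw [k3]
        linarith [abs_nonneg s.im]
      · simp [hS, mem_reProdIm, hs]; linarith
      · simp [hS, mem_reProdIm, hw]; linarith
    have g3 : ‖w - s‖ ≤ 2 * x := by
      have : w - s = ((1 + x - s.re : ℝ) : ℂ) := by apply Complex.ext <;> simp [hw]
      rw [this, norm_real, Real.norm_eq_abs, abs_le]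
      constructor <;> linarith
    have g4 : D * Y * ‖w - s‖ ≤ 2 * D * κ / Y ^ 4 := by
      calc D * Y * ‖w - s‖ ≤ D * Y * (2 * x) := by gcongr
        _ = _ := by rw [hx]; field_simp
    have g5 := norm_sub_norm_le (riemannZeta w) (riemannZeta s)
    have g6 : m * κ / Y ^ 4 = 2 * D * κ / Y ^ 4 + κ / Y ^ 4 := by rw [hm]; ring
    linarith

lemma riemannZeta₁_ne_zero_of_one_le_re {s : ℂ} (hs : 1 ≤ s.re) : riemannZeta₁ s ≠ 0 := by
  rcases eq_or_ne s 1 with rfl | h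
  · simp
  · have := riemannZeta_ne_zero_of_one_le_re hs
    rw [riemannZeta_eq_inv_sub_mul h] at this
    exact right_ne_zero_of_mul this

lemma exists_riemannZeta₁_near_one : ∃ δ C : ℝ, 0 < δ ∧ ∀ s : ℂ, 1 - δ ≤ s.re → s.re ≤ 2 →
    |s.im| ≤ 1 → riemannZeta₁ s ≠ 0 ∧ ‖deriv riemannZeta₁ s / riemannZeta₁ s‖ ≤ C := by
  have hK : IsCompact (Set.Icc (1 : ℝ) 2 ×ℂ Set.Icc (-1 : ℝ) 1) :=
    isCompact_Icc.reProdIm isCompact_Icc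
  have hopen : IsOpen {s : ℂ | riemannZeta₁ s ≠ 0} :=
    isOpen_ne_fun differentiable_riemannZeta₁.continuous continuous_const
  have hsub : (Set.Icc (1 : ℝ) 2 ×ℂ Set.Icc (-1 : ℝ) 1) ⊆ {s : ℂ | riemannZeta₁ s ≠ 0} :=
    fun s hs ↦ riemannZeta₁_ne_zero_of_one_le_re hs.1.1
  obtain ⟨δ, hδ, hδ'⟩ := hK.exists_cthickening_subset_open hopen hsub
  have hcomp : IsCompact (Metric.cthickening δ (Set.Icc (1 : ℝ) 2 ×ℂ Set.Icc (-1 : ℝ) 1)) :=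
    hK.cthickening
  have hcont : ContinuousOn (fun s ↦ deriv riemannZeta₁ s / riemannZeta₁ s)
      (Metric.cthickening δ (Set.Icc (1 : ℝ) 2 ×ℂ Set.Icc (-1 : ℝ) 1)) :=
    differentiable_riemannZeta₁.deriv.continuous.continuousOn.div
      differentiable_riemannZeta₁.continuous.continuousOn fun s hs ↦ hδ' hs
  obtain ⟨C, hC⟩ := hcomp.exists_bound_of_continuousOn hcont
  refine ⟨δ, C, hδ, fun s h1 h2 h3 ↦ ?_⟩
  have hs : s ∈ Metric.cthickening δ (Set.Icc (1 : ℝ) 2 ×ℂ Set.Icc (-1 : ℝ) 1) := by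
    have hmem : (⟨max 1 s.re, s.im⟩ : ℂ) ∈ Set.Icc (1 : ℝ) 2 ×ℂ Set.Icc (-1 : ℝ) 1 := by
      rw [mem_reProdIm]
      exact ⟨⟨le_max_left _ _, max_le (by norm_num) h2⟩, abs_le.1 h3⟩
    refine Metric.mem_cthickening_of_dist_le _ _ _ _ hmem ?_
    rw [Complex.dist_eq]
    have : s - ⟨max 1 s.re, s.im⟩ = ((s.re - max 1 s.re : ℝ) : ℂ) := by
      apply Complex.ext <;> simp
    rw [this, norm_real, Real.norm_eq_abs, abs_le]
    rcases max_cases 1 s.re with h | h <;> constructor <;> linarith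
  exact ⟨hδ' hs, hC s hs⟩

/-- A zero-free region for `ζ`, together with a bound for the logarithmic derivative. -/
lemma exists_zeroFree_region : ∃ κ C : ℝ, 0 < κ ∧ κ ≤ 1 / 400 ∧ 0 < C ∧ ∀ Y : ℝ, 1 ≤ Y →
    ∀ s : ℂ, 1 - κ / Y ^ 5 ≤ s.re → s.re ≤ 2 → |s.im| ≤ Y ^ 100 →
    riemannZeta₁ s ≠ 0 ∧ ‖deriv riemannZeta₁ s / riemannZeta₁ s‖ ≤ C * Y ^ 105 := by
  obtain ⟨κ, hκ, hκ', h1⟩ := exists_le_norm_riemannZeta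
  obtain ⟨δ, C₁, hδ, h2⟩ := exists_riemannZeta₁_near_one
  obtain ⟨C₀, hC₀, h3⟩ := exists_norm_riemannZeta₀_le_mul
  refine ⟨min κ δ, 4 * C₀ / κ + |C₁|, lt_min hκ hδ, (min_le_left _ _).trans hκ', by positivity,
    fun Y hY s g1 g2 g3 ↦ ?_⟩
  have hY0 : 0 < Y := by linarith
  have hY5 : 1 ≤ Y ^ 5 := one_le_pow₀ hY
  have hmin : min κ δ / Y ^ 5 ≤ min κ δ := div_le_self (lt_min hκ hδ).le hY5
  have hY105 : 1 ≤ Y ^ 105 := one_le_pow₀ hY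
  rcases le_total |s.im| 1 with ht | ht
  · have := h2 s (by linarith [min_le_right κ δ]) g2 ht
    refine ⟨this.1, this.2.trans ?_⟩
    have h5 : 0 < 4 * C₀ / κ := by positivity
    nlinarith [le_abs_self C₁, abs_nonneg C₁]
  · have hs1 := one_le_norm_sub_one ht
    have hne : s ≠ 1 := by rintro rfl; norm_num at hs1
    have hY100 : 1 ≤ Y ^ 100 := one_le_pow₀ hY
    have k1 : κ / Y ^ 4 ≤ ‖riemannZeta s‖ := by
      refine h1 Y hY s (le_trans ?_ g1) g2 ht g3
      gcongr
      exact min_le_left _ _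
    have k2 : κ / Y ^ 4 ≤ ‖riemannZeta₁ s‖ := by
      rw [riemannZeta_eq_inv_sub_mul hne, norm_mul, norm_inv] at k1
      refine k1.trans (mul_le_of_le_one_left (norm_nonneg _) (inv_le_one_of_one_le₀ hs1))
    have kpos : 0 < κ / Y ^ 4 := by positivity
    obtain ⟨k3, k4⟩ := h3 Y hY s (by linarith [min_le_left κ δ]) g2 (by linarith)
    have k5 : deriv riemannZeta₁ s = riemannZeta₀ s + (s - 1) * deriv riemannZeta₀ s := by
      unfold riemannZeta₁
      rw [deriv_const_add, deriv_fun_mul (by fun_prop) (by fun_prop)]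
      simp
    have k6 : ‖s - 1‖ ≤ 3 * Y ^ 100 := by
      refine (norm_le_abs_re_add_abs_im _).trans ?_
      have : |(s - 1).re| ≤ 1 := by
        rw [sub_re, one_re, abs_le]
        constructor <;> linarith [min_le_left κ δ]
      simp only [sub_im, one_im, sub_zero]
      linarith
    have k7 : ‖deriv riemannZeta₁ s‖ ≤ 4 * C₀ * Y ^ 101 := by
      rw [k5]
      calc _ ≤ ‖riemannZeta₀ s‖ + ‖s - 1‖ * ‖deriv riemannZeta₀ s‖ := by
            rw [← norm_mul]; exact norm_add_le _ _
        _ ≤ C₀ * Y + 3 * Y ^ 100 * (C₀ * Y) := by gcongr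
        _ ≤ C₀ * Y * Y ^ 100 + 3 * Y ^ 100 * (C₀ * Y) := by
            have : 0 ≤ C₀ * Y := by positivity
            nlinarith
        _ = _ := by ring
    refine ⟨norm_pos_iff.1 (kpos.trans_le k2), ?_⟩
    rw [norm_div]
    calc _ ≤ 4 * C₀ * Y ^ 101 / (κ / Y ^ 4) := by gcongr
      _ = 4 * C₀ / κ * Y ^ 105 := by field_simp
      _ ≤ _ := by
        gcongr
        linarith [abs_nonneg C₁]

end ZeroFreeRegion

section PrimeNumberTheorem

open Complex Filter Topology MeasureTheory ProbabilityTheory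
open scoped NNReal Chebyshev

/-- The relative error `(ψ(x) - x) / x` at `x = exp v`, extended by zero to `v ≤ 0`. -/
noncomputable def psiErr (v : ℝ) : ℝ :=
  if 0 < v then Real.exp (-v) * ψ (Real.exp v) - 1 else 0

/-- The Laplace transform of `psiErr`, evaluated at `s - 1`. -/
noncomputable def psiErrTransform (s : ℂ) : ℂ :=
  -(deriv riemannZeta₁ s / riemannZeta₁ s + 1) / s

lemma measurable_psiErr : Measurable psiErr := by
  unfold psiErr
  refine Measurable.ite (measurableSet_lt measurable_const measurable_id) ?_ measurable_const
  exact ((Real.measurable_exp.comp measurable_neg).mul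
    (Chebyshev.psi_mono.measurable.comp Real.measurable_exp)).sub_const 1

lemma abs_psiErr_le (v : ℝ) : |psiErr v| ≤ Real.log 4 + 5 := by
  have h4 : 0 ≤ Real.log 4 := Real.log_nonneg (by norm_num)
  unfold psiErr
  split_ifs
  · have h1 : 0 ≤ Real.exp (-v) * ψ (Real.exp v) :=
      mul_nonneg (Real.exp_pos _).le (Chebyshev.psi_nonneg _)
    have h2 : Real.exp (-v) * ψ (Real.exp v) ≤ Real.log 4 + 4 := by
      calc Real.exp (-v) * ψ (Real.exp v)
          ≤ Real.exp (-v) * ((Real.log 4 + 4) * Real.exp v) := by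
            gcongr
            exact Chebyshev.psi_le_const_mul_self (Real.exp_pos v).le
        _ = (Real.log 4 + 4) * (Real.exp (-v) * Real.exp v) := by ring
        _ = Real.log 4 + 4 := by rw [← Real.exp_add]; simp
    rw [abs_le]; constructor <;> linarith
  · simp; linarith

lemma integral_psi_mul_cexp {s : ℂ} (hs : 1 < s.re) :
    ∫ v in Set.Ioi (0 : ℝ), (ψ (Real.exp v) : ℂ) * cexp (-s * v) =
      (-deriv riemannZeta s / riemannZeta s) / s := by
  have hs0 : s ≠ 0 := by rintro rfl; simp at hs; linarith
  rw [← ArithmeticFunction.LSeries_vonMangoldt_eq_deriv_riemannZeta_div hs,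
    LSeries_eq_mul_integral_of_nonneg (fun n ↦ ArithmeticFunction.vonMangoldt n) zero_le_one
      (by simpa using hs) ?_ (fun n ↦ ArithmeticFunction.vonMangoldt_nonneg)]
  · rw [mul_div_cancel_left₀ _ hs0]
    have h := integral_comp_exp_Ioi (fun t : ℝ ↦ (ψ t : ℂ) * (t : ℂ) ^ (-(s + 1))) 0
    rw [Real.exp_zero] at h
    have h2 : ∫ t in Set.Ioi (1 : ℝ), (∑ k ∈ Finset.Icc 1 ⌊t⌋₊,
        ((ArithmeticFunction.vonMangoldt k : ℝ) : ℂ)) * (t : ℂ) ^ (-(s + 1)) =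
        ∫ t in Set.Ioi (1 : ℝ), (ψ t : ℂ) * (t : ℂ) ^ (-(s + 1)) := by
      congr 1
      ext t
      congr 1
      rw [Chebyshev.psi, ← Finset.Icc_add_one_left_eq_Ioc]
      push_cast
      rfl
    rw [h2, ← h]
    refine setIntegral_congr_fun measurableSet_Ioi fun v _ ↦ ?_
    simp only [Complex.real_smul]
    rw [mul_left_comm, Complex.ofReal_exp, cpow_def_of_ne_zero (Complex.exp_ne_zero _), ← Complex.ofReal_exp,
      ← Complex.ofReal_log (Real.exp_pos v).le, Real.log_exp, Complex.ofReal_exp, ← Complex.exp_add]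
    ring_nf
  · refine Asymptotics.IsBigO.of_bound (Real.log 4 + 4) (Eventually.of_forall fun n ↦ ?_)
    have h := Chebyshev.psi_le_const_mul_self (x := n) (Nat.cast_nonneg n)
    have h0 := Chebyshev.psi_nonneg n
    rw [Chebyshev.psi, Nat.floor_natCast, ← Finset.Icc_add_one_left_eq_Ioc] at h h0
    simp only [zero_add] at h h0
    rw [Real.norm_of_nonneg h0]
    simpa using h

lemma integral_psiErr_mul_cexp {s : ℂ} (hs : 1 < s.re) :
    ∫ v in Set.Ioi (0 : ℝ), (psiErr v : ℂ) * cexp (-(s - 1) * v) = psiErrTransform s := by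
  have hs0 : s ≠ 0 := by rintro rfl; simp at hs; linarith
  have hs1 : s - 1 ≠ 0 := by
    intro h; rw [sub_eq_zero.mp h] at hs; simp at hs
  have hs' : s ≠ 1 := sub_ne_zero.mp hs1
  have ha : (-(s - 1)).re < 0 := by simp; linarith
  have hi : IntegrableOn (fun v : ℝ ↦ cexp (-(s - 1) * v)) (Set.Ioi 0) :=
    integrableOn_exp_mul_complex_Ioi ha 0
  have hi2 : IntegrableOn (fun v : ℝ ↦ (psiErr v : ℂ) * cexp (-(s - 1) * v)) (Set.Ioi 0) := by
    refine Integrable.bdd_mul (c := Real.log 4 + 5) hi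
      (Complex.measurable_ofReal.comp measurable_psiErr).aestronglyMeasurable
      (Eventually.of_forall fun v ↦ ?_)
    simpa using abs_psiErr_le v
  have h1 : ∫ v in Set.Ioi (0 : ℝ), (ψ (Real.exp v) : ℂ) * cexp (-s * v) =
      ∫ v in Set.Ioi (0 : ℝ), ((psiErr v : ℂ) * cexp (-(s - 1) * v) + cexp (-(s - 1) * v)) := by
    refine setIntegral_congr_fun measurableSet_Ioi fun v hv ↦ ?_
    simp only [psiErr, if_pos (Set.mem_Ioi.mp hv)]
    have : cexp (-s * v) = cexp (-v) * cexp (-(s - 1) * v) := by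
      rw [← Complex.exp_add]; congr 1; ring
    rw [this]
    push_cast
    ring
  rw [integral_psi_mul_cexp hs, integral_add hi2 hi, integral_exp_mul_complex_Ioi ha] at h1
  rw [eq_sub_of_add_eq h1.symm, psiErrTransform,
    deriv_riemannZeta_eq_neg_inv_sub_sq_mul_add hs', riemannZeta_eq_inv_sub_mul hs']
  have hz : riemannZeta₁ s ≠ 0 := riemannZeta₁_ne_zero_of_one_le_re hs.le
  simp only [ofReal_zero, mul_zero, Complex.exp_zero]
  field_simp
  ring

lemma norm_psiErrTransform_le (y : ℝ) : ‖psiErrTransform (2 + y * I)‖ ≤ Real.log 4 + 5 := by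
  rw [← integral_psiErr_mul_cexp (by simp)]
  have h := norm_integral_le_of_norm_le (μ := volume.restrict (Set.Ioi 0))
    (g := fun v ↦ (Real.log 4 + 5) * Real.exp (-v))
    (f := fun v : ℝ ↦ (psiErr v : ℂ) * cexp (-(2 + y * I - 1) * v))
    ((integrableOn_exp_neg_Ioi 0).const_mul _) (Eventually.of_forall fun v ↦ by
      rw [norm_mul, Complex.norm_exp]
      simp only [norm_real, Real.norm_eq_abs]
      have : (-(2 + y * I - 1) * (v : ℂ)).re = -v := by simp; ring
      rw [this]
      gcongr
      exact abs_psiErr_le v)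
  rw [integral_const_mul, integral_exp_neg_Ioi_zero, mul_one] at h
  exact h

lemma integral_cexp_vertical_line {q : ℝ≥0} (hq : q ≠ 0) (u v : ℝ) :
    ∫ y : ℝ, cexp (-(1 + y * I) * v) * cexp ((1 + y * I) * u + q * (1 + y * I) ^ 2 / 2) =
      2 * Real.pi * gaussianPDFReal u q v := by
  have hq0 : (0 : ℝ) < q := by positivity
  have hq1 : (q : ℂ) ≠ 0 := by exact_mod_cast hq0.ne'
  have h1 : ∀ y : ℝ, cexp (-(1 + y * I) * v) * cexp ((1 + y * I) * u + q * (1 + y * I) ^ 2 / 2) =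
      cexp ((-q / 2 : ℂ) * y ^ 2 + (I * (u - v + q)) * y + (u - v + q / 2)) := by
    intro y
    rw [← Complex.exp_add]
    congr 1
    linear_combination (q * y ^ 2 / 2 : ℂ) * I_sq
  simp_rw [h1]
  rw [integral_cexp_quadratic (by
    have : (-(q : ℂ) / 2) = ((-(q : ℝ) / 2 : ℝ) : ℂ) := by push_cast; rfl
    rw [this, ofReal_re]; linarith)]
  have h2 : (u - v + q / 2 : ℂ) - (I * (u - v + q)) ^ 2 / (4 * (-q / 2)) =
      ((-(v - u) ^ 2 / (2 * q) : ℝ) : ℂ) := by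
    rw [mul_pow, I_sq]
    push_cast
    field_simp
    ring
  have h3 : ((Real.pi : ℂ) / -(-q / 2)) ^ (1 / 2 : ℂ) = ((√(2 * Real.pi / q) : ℝ) : ℂ) := by
    rw [Real.sqrt_eq_rpow, ofReal_cpow (by positivity)]
    push_cast
    congr 1
    field_simp
  rw [h2, h3, ← ofReal_exp, gaussianPDFReal_def, ← ofReal_mul]
  have h4 : √(2 * Real.pi / q) = 2 * Real.pi * (√(2 * Real.pi * q))⁻¹ := by
    rw [← div_eq_mul_inv, eq_div_iff (by positivity), ← Real.sqrt_mul (by positivity)]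
    rw [show 2 * Real.pi / q * (2 * Real.pi * q) = (2 * Real.pi) ^ 2 by field_simp]
    exact Real.sqrt_sq (by positivity)
  rw [h4]
  push_cast
  ring

lemma norm_cexp_vertical_line (u q y : ℝ) :
    ‖cexp ((1 + y * I) * u + q * (1 + y * I) ^ 2 / 2)‖ =
      Real.exp (u + q / 2) * Real.exp (-(q / 2) * y ^ 2) := by
  rw [Complex.norm_exp, ← Real.exp_add]
  congr 1
  have : (1 + y * I) * u + q * (1 + y * I) ^ 2 / 2 =
      ((u + q / 2 - q / 2 * y ^ 2 : ℝ) : ℂ) + ((y * u + q * y : ℝ) : ℂ) * I := by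
    push_cast
    linear_combination (q * y ^ 2 / 2 : ℂ) * I_sq
  rw [this, add_re, ofReal_re, re_ofReal_mul, I_re]
  ring

lemma integral_psiErr_gaussianReal {q : ℝ≥0} (hq : q ≠ 0) (u : ℝ) :
    2 * Real.pi * ((∫ v, psiErr v ∂gaussianReal u q : ℝ) : ℂ) =
      ∫ y : ℝ, psiErrTransform (2 + y * I) *
        cexp ((1 + y * I) * u + q * (1 + y * I) ^ 2 / 2) := by
  have hq0 : (0 : ℝ) < q := by positivity
  set f : ℝ → ℝ → ℂ := fun y v ↦ (psiErr v : ℂ) * (cexp (-(1 + y * I) * v) *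
    cexp ((1 + y * I) * u + q * (1 + y * I) ^ 2 / 2)) with hf
  have hfint : Integrable (Function.uncurry f)
      ((volume : Measure ℝ).prod (volume.restrict (Set.Ioi (0 : ℝ)))) := by
    have hg : Integrable (fun p : ℝ × ℝ ↦ (Real.exp (u + q / 2) * Real.exp (-(q / 2) * p.1 ^ 2)) *
        ((Real.log 4 + 5) * Real.exp (-p.2)))
        ((volume : Measure ℝ).prod (volume.restrict (Set.Ioi (0 : ℝ)))) :=
      Integrable.mul_prod ((integrable_exp_neg_mul_sq (by positivity)).const_mul _)
        ((integrableOn_exp_neg_Ioi 0).const_mul _)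
    refine hg.mono' ?_ (Eventually.of_forall fun p ↦ ?_)
    · refine ((Complex.measurable_ofReal.comp
        (measurable_psiErr.comp measurable_snd)).mul ?_).aestronglyMeasurable
      exact Continuous.measurable (by fun_prop)
    · simp only [Function.uncurry, hf]
      rw [norm_mul, norm_mul]
      have h1 := norm_cexp_vertical_line u q p.1
      rw [h1, Complex.norm_exp, norm_real, Real.norm_eq_abs]
      have : (-(1 + (p.1 : ℂ) * I) * (p.2 : ℂ)).re = -p.2 := by simp
      rw [this]
      have h2 := abs_psiErr_le p.2
      calc |psiErr p.2| * (Real.exp (-p.2) * (Real.exp (u + q / 2) * Real.exp (-(q / 2) * p.1 ^ 2)))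
          ≤ (Real.log 4 + 5) *
            (Real.exp (-p.2) * (Real.exp (u + q / 2) * Real.exp (-(q / 2) * p.1 ^ 2))) := by gcongr
        _ = _ := by ring
  have h := integral_integral_swap hfint
  have hl : ∀ y : ℝ, ∫ v in Set.Ioi (0 : ℝ), f y v = psiErrTransform (2 + y * I) *
        cexp ((1 + y * I) * u + q * (1 + y * I) ^ 2 / 2) := by
    intro y
    rw [← integral_psiErr_mul_cexp (by simp), ← integral_mul_const]
    refine integral_congr_ae (Eventually.of_forall fun v ↦ ?_)
    simp only [hf]
    rw [mul_assoc, show (2 + (y : ℂ) * I - 1) = 1 + y * I by ring]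
  have hr : ∀ v : ℝ, ∫ y : ℝ, f y v = psiErr v * (2 * Real.pi * gaussianPDFReal u q v) := by
    intro v
    rw [← integral_cexp_vertical_line hq, ← integral_const_mul]
  simp_rw [hl, hr] at h
  rw [h, integral_gaussianReal_eq_integral_smul hq]
  have h5 : ∫ v in Set.Ioi (0 : ℝ), (psiErr v : ℂ) * (2 * Real.pi * gaussianPDFReal u q v) =
      ∫ v : ℝ, (psiErr v : ℂ) * (2 * Real.pi * gaussianPDFReal u q v) := by
    refine setIntegral_eq_integral_of_forall_compl_eq_zero fun v hv ↦ ?_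
    simp [psiErr, if_neg (show ¬ 0 < v from hv)]
  rw [h5, ← integral_complex_ofReal, ← integral_const_mul]
  refine integral_congr_ae (Eventually.of_forall fun v ↦ ?_)
  simp only [smul_eq_mul]
  push_cast
  ring

lemma norm_cexp_gaussian_factor (s : ℂ) (w q : ℝ) :
    ‖cexp ((s - 1) * w + q * (s - 1) ^ 2 / 2)‖ =
      Real.exp ((s.re - 1) * w + q / 2 * (s.re - 1) ^ 2 - q / 2 * s.im ^ 2) := by
  rw [Complex.norm_exp]
  congr 1
  have : (s - 1) * w + q * (s - 1) ^ 2 / 2 =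
      (((s.re - 1) * w + q / 2 * (s.re - 1) ^ 2 - q / 2 * s.im ^ 2 : ℝ) : ℂ) +
      ((s.im * w + q * (s.re - 1) * s.im : ℝ) : ℂ) * I := by
    conv_lhs => rw [← re_add_im s]
    push_cast
    linear_combination (q * s.im ^ 2 / 2 : ℂ) * I_sq
  rw [this, add_re, ofReal_re, re_ofReal_mul, I_re]
  ring

lemma norm_integral_vertical_line_le {H : ℂ → ℂ} {η R B M w q : ℝ} (hη : 0 < η) (hη1 : η ≤ 1)
    (hR : 0 < R) (hw : 0 ≤ w) (hq : 0 < q) (hq1 : q ≤ 1) (hB0 : 0 ≤ B)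
    (hH : DifferentiableOn ℂ H (Set.Icc (1 - η) 2 ×ℂ Set.Icc (-R) R))
    (hB : ∀ s ∈ Set.Icc (1 - η) 2 ×ℂ Set.Icc (-R) R, ‖H s‖ ≤ B)
    (hc : Continuous fun y : ℝ ↦ H (2 + y * I)) (hM : ∀ y : ℝ, ‖H (2 + y * I)‖ ≤ M) :
    ‖∫ y : ℝ, H (2 + y * I) * cexp ((1 + y * I) * w + q * (1 + y * I) ^ 2 / 2)‖ ≤
      2 * R * (B * Real.exp (1 - η * w)) + 4 * (B * Real.exp (w + 1 - q / 2 * R ^ 2)) +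
        M * Real.exp (w + 1 - q / 4 * R ^ 2) * √(Real.pi / (q / 4)) := by
  have hM0 : 0 ≤ M := (norm_nonneg _).trans (hM 0)
  set F : ℂ → ℂ := fun s ↦ H s * cexp ((s - 1) * w + q * (s - 1) ^ 2 / 2) with hF
  have hline : ∀ y : ℝ, H (2 + y * I) * cexp ((1 + y * I) * w + q * (1 + y * I) ^ 2 / 2) =
      F (((2 : ℝ) : ℂ) + y * I) := by
    intro y
    simp only [hF]
    push_cast
    rw [show (2 + (y : ℂ) * I - 1) = 1 + y * I by ring]
  have hFnorm : ∀ s, ‖F s‖ = ‖H s‖ *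
      Real.exp ((s.re - 1) * w + q / 2 * (s.re - 1) ^ 2 - q / 2 * s.im ^ 2) := by
    intro s
    simp only [hF]
    rw [norm_mul, norm_cexp_gaussian_factor]
  simp_rw [hline]
  have hdom : ∀ y : ℝ, ‖F (((2 : ℝ) : ℂ) + y * I)‖ ≤
      M * (Real.exp (w + q / 2) * Real.exp (-(q / 2) * y ^ 2)) := by
    intro y
    rw [hFnorm, ← Real.exp_add]
    refine mul_le_mul ?_ (Real.exp_le_exp.mpr ?_) (Real.exp_pos _).le hM0
    · simpa using hM y
    · simp; linarith
  have hcont : Continuous fun y : ℝ ↦ F (((2 : ℝ) : ℂ) + y * I) := by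
    simp_rw [← hline]
    exact hc.mul (by fun_prop)
  have hintF : Integrable fun y : ℝ ↦ F (((2 : ℝ) : ℂ) + y * I) :=
    (((integrable_exp_neg_mul_sq (by positivity)).const_mul _).const_mul _).mono'
      hcont.aestronglyMeasurable (Eventually.of_forall hdom)
  have hsplit : ∫ y : ℝ, F (((2 : ℝ) : ℂ) + y * I) =
      (∫ y in (-R)..R, F (((2 : ℝ) : ℂ) + y * I)) +
        ∫ y in (Set.Ioc (-R) R)ᶜ, F (((2 : ℝ) : ℂ) + y * I) := by
    rw [intervalIntegral.integral_of_le (by linarith),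
      integral_add_compl measurableSet_Ioc hintF]
  have htail : ‖∫ y in (Set.Ioc (-R) R)ᶜ, F (((2 : ℝ) : ℂ) + y * I)‖ ≤
      M * Real.exp (w + 1 - q / 4 * R ^ 2) * √(Real.pi / (q / 4)) := by
    have hg : Integrable fun y : ℝ ↦
        M * Real.exp (w + 1 - q / 4 * R ^ 2) * Real.exp (-(q / 4) * y ^ 2) :=
      (integrable_exp_neg_mul_sq (by positivity)).const_mul _
    calc ‖∫ y in (Set.Ioc (-R) R)ᶜ, F (((2 : ℝ) : ℂ) + y * I)‖
        ≤ ∫ y in (Set.Ioc (-R) R)ᶜ,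
            M * Real.exp (w + 1 - q / 4 * R ^ 2) * Real.exp (-(q / 4) * y ^ 2) := by
          refine norm_integral_le_of_norm_le hg.integrableOn ?_
          refine (ae_restrict_iff' measurableSet_Ioc.compl).mpr (Eventually.of_forall fun y hy ↦ ?_)
          refine (hdom y).trans ?_
          rw [mul_assoc, ← Real.exp_add, ← Real.exp_add]
          have hy2 : R ^ 2 ≤ y ^ 2 := by
            rw [sq_le_sq, abs_of_pos hR]
            simp only [Set.mem_compl_iff, Set.mem_Ioc, not_and_or, not_lt, not_le] at hy
            rcases hy with hy | hy
            · rw [le_abs]; right; linarith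
            · exact hy.le.trans (le_abs_self y)
          refine mul_le_mul_of_nonneg_left (Real.exp_le_exp.mpr ?_) hM0
          nlinarith
      _ ≤ ∫ y, M * Real.exp (w + 1 - q / 4 * R ^ 2) * Real.exp (-(q / 4) * y ^ 2) :=
          setIntegral_le_integral hg (Eventually.of_forall fun y ↦ by positivity)
      _ = _ := by rw [integral_const_mul, integral_gaussian]
  have hrect := Complex.integral_boundary_rect_eq_zero_of_differentiableOn F
    (((1 - η : ℝ) : ℂ) + ((-R : ℝ) : ℂ) * I) (((2 : ℝ) : ℂ) + (R : ℂ) * I) (by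
      have : Set.uIcc (1 - η) 2 = Set.Icc (1 - η) 2 := Set.uIcc_of_le (by linarith)
      have h2 : Set.uIcc (-R) R = Set.Icc (-R) R := Set.uIcc_of_le (by linarith)
      simp only [add_re, ofReal_re, re_ofReal_mul, I_re, mul_zero, add_zero, add_im, ofReal_im,
        im_ofReal_mul, I_im, mul_one, zero_add]
      rw [this, h2]
      exact hH.mul (by fun_prop))
  simp only [add_re, ofReal_re, re_ofReal_mul, I_re, mul_zero, add_zero, add_im, ofReal_im,
        im_ofReal_mul, I_im, mul_one, zero_add] at hrect
  have hhor : ∀ t : ℝ, |t| = R → ‖∫ x in (1 - η)..2, F ((x : ℂ) + (t : ℂ) * I)‖ ≤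
      2 * (B * Real.exp (w + 1 - q / 2 * R ^ 2)) := by
    intro t ht
    refine (intervalIntegral.norm_integral_le_of_norm_le_const
      (C := B * Real.exp (w + 1 - q / 2 * R ^ 2)) fun x hx ↦ ?_).trans ?_
    · rw [Set.uIoc_of_le (by linarith)] at hx
      rw [hFnorm]
      refine mul_le_mul (hB _ ?_) (Real.exp_le_exp.mpr ?_) (Real.exp_pos _).le hB0
      · have := abs_le.mp ht.le
        rw [mem_reProdIm]
        simp only [add_re, ofReal_re, re_ofReal_mul, I_re, mul_zero, add_zero, add_im, ofReal_im,
          im_ofReal_mul, I_im, mul_one, zero_add]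
        exact ⟨⟨hx.1.le, hx.2⟩, this⟩
      · simp only [add_re, ofReal_re, re_ofReal_mul, I_re, mul_zero, add_zero, add_im, ofReal_im,
          im_ofReal_mul, I_im, mul_one, zero_add]
        have h1 : t ^ 2 = R ^ 2 := by rw [← sq_abs, ht]
        have h2 : (x - 1) * w ≤ w := mul_le_of_le_one_left hw (by linarith [hx.2])
        have h3 : (x - 1) ^ 2 ≤ 1 := by
          rw [sq_le_one_iff_abs_le_one, abs_le]; constructor <;> linarith [hx.1, hx.2]
        rw [h1]
        nlinarith
    · rw [mul_comm]
      gcongr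
      rw [abs_of_nonneg] <;> linarith
  have hleft : ‖∫ y in (-R)..R, F (((1 - η : ℝ) : ℂ) + (y : ℂ) * I)‖ ≤
      2 * R * (B * Real.exp (1 - η * w)) := by
    refine (intervalIntegral.norm_integral_le_of_norm_le_const
      (C := B * Real.exp (1 - η * w)) fun y hy ↦ ?_).trans ?_
    · rw [Set.uIoc_of_le (by linarith)] at hy
      rw [hFnorm]
      refine mul_le_mul (hB _ ?_) (Real.exp_le_exp.mpr ?_) (Real.exp_pos _).le hB0
      · rw [mem_reProdIm]
        simp only [add_re, ofReal_re, re_ofReal_mul, I_re, mul_zero, add_zero, add_im, ofReal_im,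
          im_ofReal_mul, I_im, mul_one, zero_add]
        exact ⟨⟨le_rfl, by linarith⟩, hy.1.le, hy.2⟩
      · simp only [add_re, ofReal_re, re_ofReal_mul, I_re, mul_zero, add_zero, add_im, ofReal_im,
          im_ofReal_mul, I_im, mul_one, zero_add]
        have h1 : 0 ≤ q / 2 * y ^ 2 := by positivity
        have h2 : η ^ 2 ≤ 1 := pow_le_one₀ hη.le hη1
        nlinarith
    · rw [mul_comm, abs_of_nonneg (by linarith)]
      exact le_of_eq (by ring)
  set L := ∫ y in (-R)..R, F (((1 - η : ℝ) : ℂ) + (y : ℂ) * I)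
  set V := ∫ y in (-R)..R, F (((2 : ℝ) : ℂ) + (y : ℂ) * I)
  have hV : ‖V‖ ≤ 2 * R * (B * Real.exp (1 - η * w)) +
      4 * (B * Real.exp (w + 1 - q / 2 * R ^ 2)) := by
    have h1 := hhor (-R) (by rw [abs_neg, abs_of_pos hR])
    have h2 := hhor R (abs_of_pos hR)
    set b := ∫ x in (1 - η)..2, F ((x : ℂ) + ((-R : ℝ) : ℂ) * I)
    set t := ∫ x in (1 - η)..2, F ((x : ℂ) + (R : ℂ) * I)
    have h3 : I • V = I • L - b + t := by linear_combination hrect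
    calc ‖V‖ = ‖I • V‖ := by rw [norm_smul, norm_I, one_mul]
      _ = ‖I • L - b + t‖ := by rw [h3]
      _ ≤ ‖I • L‖ + ‖b‖ + ‖t‖ := (norm_add_le _ _).trans (by gcongr; exact norm_sub_le _ _)
      _ = ‖L‖ + ‖b‖ + ‖t‖ := by rw [norm_smul, norm_I, one_mul]
      _ ≤ _ := by linarith
  rw [hsplit]
  exact (norm_add_le _ _).trans (add_le_add hV htail)

lemma eventually_abs_integral_psiErr_le : ∀ᶠ Y : ℝ in atTop, ∀ q : ℝ≥0, (q : ℝ) = (Y ^ 100)⁻¹ →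
    ∀ w : ℝ, Y ^ 10 / 2 ≤ w → w ≤ 2 * Y ^ 10 →
    |∫ v, psiErr v ∂gaussianReal w q| ≤ (Y ^ 25)⁻¹ := by
  obtain ⟨κ, C, hκ, hκ1, hC, hzf⟩ := exists_zeroFree_region
  set M := Real.log 4 + 5 with hMdef
  have hM0 : 0 < M := by
    have : 0 ≤ Real.log 4 := Real.log_nonneg (by norm_num)
    positivity
  set K := 2 * (2 * (C + 1)) * Real.exp 1 + 4 * (2 * (C + 1)) * Real.exp 1 +
    M * Real.exp 1 * 4 with hK
  have hlim : ∀ᶠ Y : ℝ in atTop, K * (Y ^ 230 * Real.exp (-(κ / 2) * Y)) ≤ 1 := by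
    have h1 := (isLittleO_pow_exp_pos_mul_atTop (k := 230) (half_pos hκ)).tendsto_div_nhds_zero
    have h2 := h1.const_mul K
    rw [mul_zero] at h2
    filter_upwards [h2.eventually (ge_mem_nhds one_pos)] with Y hY
    rw [neg_mul, Real.exp_neg, ← div_eq_mul_inv]
    exact hY
  filter_upwards [hlim, eventually_ge_atTop 2] with Y hlimY hY q hq w hw1 hw2
  have hY1 : 1 ≤ Y := by linarith
  have hY0 : 0 < Y := by linarith
  have hq0 : (0 : ℝ) < q := by rw [hq]; positivity
  have hqne : q ≠ 0 := by rintro rfl; simp at hq0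
  have hη : κ / Y ^ 5 ≤ 1 / 2 := by
    rw [div_le_iff₀ (by positivity)]
    have := one_le_pow₀ (n := 5) hY1
    linarith
  have hreg : ∀ s ∈ Set.Icc (1 - κ / Y ^ 5) 2 ×ℂ Set.Icc (-(Y ^ 100)) (Y ^ 100),
      riemannZeta₁ s ≠ 0 ∧ ‖deriv riemannZeta₁ s / riemannZeta₁ s‖ ≤ C * Y ^ 105 := fun s hs ↦
    hzf Y hY1 s hs.1.1 hs.1.2 (abs_le.mpr hs.2)
  have hre : ∀ s ∈ Set.Icc (1 - κ / Y ^ 5) 2 ×ℂ Set.Icc (-(Y ^ 100)) (Y ^ 100), 1 / 2 ≤ s.re :=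
    fun s hs ↦ by linarith [hs.1.1]
  have hs0 : ∀ s : ℂ, 1 / 2 ≤ s.re → s ≠ 0 := by rintro s hs rfl; norm_num at hs
  have hmain := norm_integral_vertical_line_le (H := psiErrTransform) (η := κ / Y ^ 5)
    (R := Y ^ 100) (B := 2 * (C + 1) * Y ^ 105) (M := M) (w := w) (q := q) (by positivity)
    (by linarith) (by positivity) ((by positivity : 0 ≤ Y ^ 10 / 2).trans hw1) hq0
    (by rw [hq]; exact inv_le_one_of_one_le₀ (one_le_pow₀ hY1)) (by positivity)
    (by
      intro s hs
      refine DifferentiableAt.differentiableWithinAt ?_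
      unfold psiErrTransform
      have h1 := (hreg s hs).1
      have h2 := hs0 s (hre s hs)
      have h3 : DifferentiableAt ℂ (deriv riemannZeta₁) s := differentiable_riemannZeta₁.deriv s
      have h4 : DifferentiableAt ℂ riemannZeta₁ s := differentiable_riemannZeta₁ s
      exact ((h3.div h4 h1).add_const 1).neg.div differentiableAt_id h2)
    (by
      intro s hs
      unfold psiErrTransform
      have h1 := (hreg s hs).2
      have h2 : 1 / 2 ≤ ‖s‖ := (hre s hs).trans ((le_abs_self _).trans (abs_re_le_norm s))
      have h3 : 1 ≤ Y ^ 105 := one_le_pow₀ hY1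
      rw [norm_div, norm_neg, div_le_iff₀ (by linarith)]
      have h4 := norm_add_le (deriv riemannZeta₁ s / riemannZeta₁ s) 1
      rw [norm_one] at h4
      have h5 : (C + 1) * Y ^ 105 * (1 / 2) ≤ (C + 1) * Y ^ 105 * ‖s‖ := by gcongr
      linarith)
    (by
      unfold psiErrTransform
      have h1 : ∀ y : ℝ, riemannZeta₁ (2 + y * I) ≠ 0 := fun y ↦
        riemannZeta₁_ne_zero_of_one_le_re (by simp)
      have h2 : ∀ y : ℝ, (2 + y * I : ℂ) ≠ 0 := fun y ↦ hs0 _ (by norm_num)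
      have h3 := differentiable_riemannZeta₁.continuous
      have h4 := differentiable_riemannZeta₁.deriv.continuous
      have h5 : Continuous fun y : ℝ ↦ (2 + y * I : ℂ) := by fun_prop
      exact ((((h4.comp h5).div (h3.comp h5) h1).add continuous_const).neg).div h5 h2)
    norm_psiErrTransform_le
  have hid := integral_psiErr_gaussianReal hqne w
  set J := ∫ v, psiErr v ∂gaussianReal w q
  have hnorm : ‖(2 * Real.pi * J : ℂ)‖ = 2 * Real.pi * |J| := by
    rw [norm_mul, norm_mul, norm_real, norm_real, Real.norm_eq_abs, Real.norm_eq_abs,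
      abs_of_pos Real.pi_pos]
    simp
  rw [← hid, hnorm] at hmain
  have hJ1 : |J| ≤ 2 * Real.pi * |J| :=
    le_mul_of_one_le_left (abs_nonneg _) (by linarith [Real.pi_gt_three])
  have hpow : Y ^ 100 = Y ^ 90 * Y ^ 10 := by ring
  have hY90 : 16 ≤ Y ^ 90 := by
    calc (16 : ℝ) ≤ 2 ^ 90 := by norm_num
      _ ≤ Y ^ 90 := by gcongr
  have hY10 : Y ≤ Y ^ 10 := le_self_pow₀ hY1 (by norm_num)
  have hqR : (q : ℝ) * (Y ^ 100) ^ 2 = Y ^ 100 := by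
    rw [hq, sq, inv_mul_cancel_left₀ (by positivity)]
  have hbig : 16 * Y ^ 10 ≤ Y ^ 100 := by rw [hpow]; gcongr
  have e1 : Real.exp (1 - κ / Y ^ 5 * w) ≤ Real.exp 1 * Real.exp (-(κ / 2) * Y) := by
    rw [← Real.exp_add, Real.exp_le_exp]
    have h1 : κ / Y ^ 5 * (Y ^ 10 / 2) ≤ κ / Y ^ 5 * w := by gcongr
    have h2 : κ / Y ^ 5 * (Y ^ 10 / 2) = κ / 2 * Y ^ 5 := by field_simp
    have h3 : κ / 2 * Y ≤ κ / 2 * Y ^ 5 := by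
      gcongr
      exact le_self_pow₀ hY1 (by norm_num)
    linarith
  have hκY : κ / 2 * Y ≤ Y := mul_le_of_le_one_left hY0.le (by linarith)
  have e2 : Real.exp (w + 1 - q / 2 * (Y ^ 100) ^ 2) ≤
      Real.exp 1 * Real.exp (-(κ / 2) * Y) := by
    rw [← Real.exp_add, Real.exp_le_exp]
    linarith
  have e3 : Real.exp (w + 1 - q / 4 * (Y ^ 100) ^ 2) ≤
      Real.exp 1 * Real.exp (-(κ / 2) * Y) := by
    rw [← Real.exp_add, Real.exp_le_exp]
    linarith
  have e4 : √(Real.pi / (q / 4)) ≤ 4 * Y ^ 50 := by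
    refine Real.sqrt_le_iff.mpr ⟨by positivity, ?_⟩
    rw [hq]
    have : Real.pi / ((Y ^ 100)⁻¹ / 4) = Real.pi * 4 * Y ^ 100 := by field_simp
    rw [this]
    have h1 : Real.pi * 4 ≤ 16 := by linarith [Real.pi_le_four]
    calc Real.pi * 4 * Y ^ 100 ≤ 16 * Y ^ 100 := by gcongr
      _ = (4 * Y ^ 50) ^ 2 := by ring
  set E := Real.exp (-(κ / 2) * Y)
  have hE : 0 < E := Real.exp_pos _
  have p1 : Y ^ 105 ≤ Y ^ 205 := pow_le_pow_right₀ hY1 (by norm_num)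
  have p2 : Y ^ 50 ≤ Y ^ 205 := pow_le_pow_right₀ hY1 (by norm_num)
  have hfin : |J| ≤ K * (Y ^ 205 * E) := by
    calc |J| ≤ _ := hJ1.trans hmain
      _ ≤ 2 * Y ^ 100 * (2 * (C + 1) * Y ^ 105 * (Real.exp 1 * E)) +
          4 * (2 * (C + 1) * Y ^ 105 * (Real.exp 1 * E)) +
          M * (Real.exp 1 * E) * (4 * Y ^ 50) := by gcongr
      _ = 2 * (2 * (C + 1)) * Real.exp 1 * (Y ^ 205 * E) +
          4 * (2 * (C + 1)) * Real.exp 1 * (Y ^ 105 * E) +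
          M * Real.exp 1 * 4 * (Y ^ 50 * E) := by ring
      _ ≤ 2 * (2 * (C + 1)) * Real.exp 1 * (Y ^ 205 * E) +
          4 * (2 * (C + 1)) * Real.exp 1 * (Y ^ 205 * E) +
          M * Real.exp 1 * 4 * (Y ^ 205 * E) := by gcongr
      _ = K * (Y ^ 205 * E) := by rw [hK]; ring
  rw [← one_div, le_div_iff₀ (by positivity)]
  calc |J| * Y ^ 25 ≤ K * (Y ^ 205 * E) * Y ^ 25 := by gcongr
    _ = K * (Y ^ 230 * E) := by ring
    _ ≤ 1 := hlimY

lemma psiErr_le_psiErr_add {a b : ℝ} (ha : 0 < a) (hab : a ≤ b) (hba : b ≤ a + 1) :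
    psiErr a ≤ psiErr b + 2 * (b - a) * (Real.log 4 + 6) := by
  have hM := (abs_le.mp (abs_psiErr_le b)).2
  have h1 : 1 + psiErr a = Real.exp (-a) * ψ (Real.exp a) := by simp [psiErr, ha]
  have h2 : 1 + psiErr b = Real.exp (-b) * ψ (Real.exp b) := by simp [psiErr, ha.trans_le hab]
  have h0 : 0 ≤ 1 + psiErr b := by
    rw [h2]; exact mul_nonneg (Real.exp_pos _).le (Chebyshev.psi_nonneg _)
  have h3 : 1 + psiErr a ≤ Real.exp (b - a) * (1 + psiErr b) := by
    rw [h1, h2, ← mul_assoc, ← Real.exp_add, show b - a + -b = -a by ring]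
    gcongr
  have h4 : Real.exp (b - a) ≤ 1 + 2 * (b - a) := by
    have h := Real.abs_exp_sub_one_le (x := b - a) (by rw [abs_le]; constructor <;> linarith)
    rw [abs_of_nonneg (sub_nonneg.mpr hab)] at h
    linarith [(abs_le.mp h).2]
  have h5 : Real.exp (b - a) * (1 + psiErr b) ≤ (1 + 2 * (b - a)) * (1 + psiErr b) := by gcongr
  have h6 : 2 * (b - a) * (1 + psiErr b) ≤ 2 * (b - a) * (Real.log 4 + 6) := by
    exact mul_le_mul_of_nonneg_left (by linarith) (by linarith)
  linarith

lemma integrable_sub_sq_gaussianReal (w : ℝ) (q : ℝ≥0) :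
    Integrable (fun v ↦ (v - w) ^ 2) (gaussianReal w q) := by
  have h : MemLp (id : ℝ → ℝ) 2 (gaussianReal w q) := memLp_id_gaussianReal 2
  exact (h.sub (memLp_const w)).integrable_sq

lemma integral_sub_sq_gaussianReal (w : ℝ) (q : ℝ≥0) :
    ∫ v, (v - w) ^ 2 ∂gaussianReal w q = q := by
  have h := variance_id_gaussianReal (μ := w) (v := q)
  rw [variance_eq_integral aemeasurable_id] at h
  simpa using h

lemma integrable_psiErr_gaussianReal (w : ℝ) (q : ℝ≥0) : Integrable psiErr (gaussianReal w q) :=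
  Integrable.of_bound measurable_psiErr.aestronglyMeasurable _
    (Eventually.of_forall abs_psiErr_le)

lemma exists_eventually_abs_psiErr_le : ∃ K : ℝ, ∀ᶠ Y : ℝ in atTop,
    |psiErr (Y ^ 10)| ≤ K * (Y ^ 25)⁻¹ := by
  set M := Real.log 4 + 5 with hM
  have hM0 : 0 < M := by
    have : 0 ≤ Real.log 4 := Real.log_nonneg (by norm_num)
    positivity
  refine ⟨1 + 4 * (M + 1) + 2 * M, ?_⟩
  filter_upwards [eventually_abs_integral_psiErr_le, eventually_ge_atTop 2] with Y h hY
  have hY1 : 1 ≤ Y := by linarith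
  have hY0 : 0 < Y := by linarith
  set u := Y ^ 10 with hu
  set r := (Y ^ 25)⁻¹ with hr
  have hr0 : 0 < r := by positivity
  have hr1 : r ≤ 1 / 2 := by
    rw [hr, one_div]
    gcongr
    exact hY.trans (le_self_pow₀ hY1 (by norm_num))
  have hu2 : 2 ≤ u := hY.trans (le_self_pow₀ hY1 (by norm_num))
  set q : ℝ≥0 := ⟨(Y ^ 100)⁻¹, by positivity⟩ with hq
  have hq' : (q : ℝ) = (Y ^ 100)⁻¹ := rfl
  have hqr : q / r ^ 2 ≤ r := by
    rw [div_le_iff₀ (by positivity), hq', hr, ← pow_succ', ← inv_pow, ← inv_pow, ← pow_mul]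
    exact pow_le_pow_of_le_one (by positivity) (inv_le_one_of_one_le₀ hY1) (by norm_num)
  have hfar : ∀ w v : ℝ, r < |v - w| → 1 ≤ (v - w) ^ 2 / r ^ 2 := by
    intro w v hv
    rw [one_le_div (by positivity), ← sq_abs (v - w)]
    gcongr
  have hsqint : ∀ w : ℝ, Integrable (fun v ↦ 2 * M * ((v - w) ^ 2 / r ^ 2)) (gaussianReal w q) :=
    fun w ↦ ((integrable_sub_sq_gaussianReal w q).div_const _).const_mul _
  have hsq : ∀ w : ℝ, ∫ v, 2 * M * ((v - w) ^ 2 / r ^ 2) ∂gaussianReal w q ≤ 2 * M * r := by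
    intro w
    rw [integral_const_mul, integral_div, integral_sub_sq_gaussianReal]
    gcongr
  have hb := fun v ↦ abs_le.mp (abs_psiErr_le v)
  rw [abs_le]
  constructor
  · have h1 := (abs_le.mp (h q hq' (u - r) (by linarith) (by linarith))).1
    have h2 : ∫ v, psiErr v ∂gaussianReal (u - r) q ≤ ∫ v, (psiErr u + 4 * r * (M + 1) +
        2 * M * ((v - (u - r)) ^ 2 / r ^ 2)) ∂gaussianReal (u - r) q := by
      refine integral_mono (integrable_psiErr_gaussianReal _ _)
        ((integrable_const _).add (hsqint _)) fun v ↦ ?_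
      by_cases hv : |v - (u - r)| ≤ r
      · rw [abs_le] at hv
        have h3 := psiErr_le_psiErr_add (a := v) (b := u) (by linarith) (by linarith) (by linarith)
        have h4 : 2 * (u - v) * (Real.log 4 + 6) ≤ 2 * (2 * r) * (M + 1) :=
          mul_le_mul (by linarith) (by linarith) (by linarith) (by linarith)
        have h5 : 0 ≤ 2 * M * ((v - (u - r)) ^ 2 / r ^ 2) := by positivity
        simp only
        linarith
      · have h3 := hfar (u - r) v (not_le.mp hv)
        have h4 : 0 ≤ 4 * r * (M + 1) := by positivity
        have h5 : 2 * M * 1 ≤ 2 * M * ((v - (u - r)) ^ 2 / r ^ 2) := by gcongr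
        simp only
        linarith [(hb v).2, (hb u).1]
    rw [integral_add (integrable_const _) (hsqint _), integral_const] at h2
    simp only [probReal_univ, one_smul] at h2
    linarith [hsq (u - r)]
  · have h1 := (abs_le.mp (h q hq' (u + r) (by linarith) (by linarith))).2
    have h2 : ∫ v, (psiErr u - 4 * r * (M + 1) -
        2 * M * ((v - (u + r)) ^ 2 / r ^ 2)) ∂gaussianReal (u + r) q ≤
        ∫ v, psiErr v ∂gaussianReal (u + r) q := by
      refine integral_mono ((integrable_const _).sub (hsqint _))
        (integrable_psiErr_gaussianReal _ _) fun v ↦ ?_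
      by_cases hv : |v - (u + r)| ≤ r
      · rw [abs_le] at hv
        have h3 := psiErr_le_psiErr_add (a := u) (b := v) (by linarith) (by linarith) (by linarith)
        have h4 : 2 * (v - u) * (Real.log 4 + 6) ≤ 2 * (2 * r) * (M + 1) :=
          mul_le_mul (by linarith) (by linarith) (by linarith) (by linarith)
        have h5 : 0 ≤ 2 * M * ((v - (u + r)) ^ 2 / r ^ 2) := by positivity
        simp only
        linarith
      · have h3 := hfar (u + r) v (not_le.mp hv)
        have h4 : 0 ≤ 4 * r * (M + 1) := by positivity
        have h5 : 2 * M * 1 ≤ 2 * M * ((v - (u + r)) ^ 2 / r ^ 2) := by gcongr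
        simp only
        linarith [(hb v).1, (hb u).2]
    rw [integral_sub (integrable_const _) (hsqint _), integral_const] at h2
    simp only [probReal_univ, one_smul] at h2
    linarith [hsq (u + r)]

lemma eventually_abs_psi_sub_le {ε : ℝ} (hε : 0 < ε) : ∀ᶠ x : ℝ in atTop,
    |ψ x - x| ≤ ε * (x / Real.log x ^ 2) := by
  obtain ⟨K, hK⟩ := exists_eventually_abs_psiErr_le
  have h1 : Tendsto (fun x : ℝ ↦ Real.log x ^ (1 / 10 : ℝ)) atTop atTop :=
    (tendsto_rpow_atTop (by norm_num)).comp Real.tendsto_log_atTop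
  have h2 : ∀ᶠ Y : ℝ in atTop, K * (Y ^ 5)⁻¹ ≤ ε := by
    have h3 : Tendsto (fun Y : ℝ ↦ K * (Y ^ 5)⁻¹) atTop (𝓝 (K * 0)) :=
      ((tendsto_pow_atTop (by norm_num)).inv_tendsto_atTop).const_mul K
    rw [mul_zero] at h3
    exact h3.eventually (ge_mem_nhds hε)
  filter_upwards [h1.eventually hK, h1.eventually h2, eventually_gt_atTop 1] with x g1 g2 hx
  have hx0 : 0 < x := by linarith
  have hL : 0 < Real.log x := Real.log_pos hx
  set Y := Real.log x ^ (1 / 10 : ℝ) with hY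
  have hY0 : 0 < Y := Real.rpow_pos_of_pos hL _
  have hYL : Y ^ 10 = Real.log x := by
    rw [hY, ← Real.rpow_natCast, ← Real.rpow_mul hL.le]
    norm_num
  rw [hYL, psiErr, if_pos hL, Real.exp_neg, Real.exp_log hx0] at g1
  have h3 : |ψ x - x| = x * |x⁻¹ * ψ x - 1| := by
    rw [← abs_of_pos hx0, ← abs_mul, abs_of_pos hx0]
    congr 1
    field_simp
  rw [h3, ← hYL]
  calc x * |x⁻¹ * ψ x - 1| ≤ x * (K * (Y ^ 25)⁻¹) := by gcongr
    _ = (K * (Y ^ 5)⁻¹) * (x / (Y ^ 10) ^ 2) := by field_simp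
    _ ≤ ε * (x / (Y ^ 10) ^ 2) := by gcongr

lemma eventually_log_pow_le {ε : ℝ} (hε : 0 < ε) (n : ℕ) :
    ∀ᶠ x : ℝ in atTop, Real.log x ^ n ≤ ε * x := by
  filter_upwards [(Real.isLittleO_pow_log_id_atTop (n := n)).bound hε, eventually_ge_atTop 0]
    with x hx h0
  rw [id, Real.norm_of_nonneg h0] at hx
  exact (le_abs_self _).trans hx

lemma eventually_abs_theta_sub_le {ε : ℝ} (hε : 0 < ε) : ∀ᶠ x : ℝ in atTop,
    |θ x - x| ≤ ε * (x / Real.log x ^ 2) := by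
  filter_upwards [eventually_abs_psi_sub_le (half_pos hε),
    Real.tendsto_sqrt_atTop.eventually (eventually_log_pow_le (by positivity : 0 < ε / 32) 3),
    eventually_gt_atTop 1] with x h1 h2 hx
  have hx0 : 0 < x := by linarith
  have hL : 0 < Real.log x := Real.log_pos hx
  have h3 := Chebyshev.psi_sub_theta_le hx.le
  have h4 := Chebyshev.theta_le_psi x
  rw [Real.log_sqrt hx0.le] at h2
  have h5 : 2 * √x * Real.log x ≤ ε / 2 * (x / Real.log x ^ 2) := by
    rw [← mul_div_assoc, le_div_iff₀ (by positivity)]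
    have h6 := Real.mul_self_sqrt hx0.le
    have h7 : 0 < √x := Real.sqrt_pos.mpr hx0
    calc 2 * √x * Real.log x * Real.log x ^ 2 = 16 * √x * (Real.log x / 2) ^ 3 := by ring
      _ ≤ 16 * √x * (ε / 32 * √x) := by gcongr
      _ = ε / 2 * (√x * √x) := by ring
      _ = ε / 2 * x := by rw [h6]
  rw [abs_le] at h1 ⊢
  constructor <;> linarith

lemma hasDerivAt_mul_div_log_pow (a c : ℝ) {t : ℝ} (ht : 1 < t) :
    HasDerivAt (fun t ↦ a * (t / Real.log t ^ 2) + c * (t / Real.log t ^ 3))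
      (a / Real.log t ^ 2 + (c - 2 * a) / Real.log t ^ 3 - 3 * c / Real.log t ^ 4) t := by
  have ht0 : t ≠ 0 := by linarith
  have hL : Real.log t ≠ 0 := (Real.log_pos ht).ne'
  have hl := Real.hasDerivAt_log ht0
  have h : HasDerivAt (fun t ↦ a * (t / Real.log t ^ 2) + c * (t / Real.log t ^ 3)) _ t :=
    (((hasDerivAt_id t).div (hl.pow 2) (pow_ne_zero 2 hL)).const_mul a).add
      (((hasDerivAt_id t).div (hl.pow 3) (pow_ne_zero 3 hL)).const_mul c)
  refine h.congr_deriv ?_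
  simp only [id, Pi.pow_apply, Nat.cast_ofNat]
  field_simp
  ring

lemma intervalIntegrable_theta_div {a b : ℝ} (ha : 2 ≤ a) (hab : a ≤ b) :
    IntervalIntegrable (fun t ↦ θ t / (t * Real.log t ^ 2)) volume a b := by
  rw [intervalIntegrable_iff_integrableOn_Icc_of_le hab]
  exact (Chebyshev.integrableOn_theta_div_id_mul_log_sq b).mono_set (Set.Icc_subset_Icc_left ha)

lemma integral_deriv_mul_div_log_pow (a c : ℝ) {t x : ℝ} (ht : 1 < t) (hx : t ≤ x) :
    IntervalIntegrable (fun t ↦ a / Real.log t ^ 2 + (c - 2 * a) / Real.log t ^ 3 -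
      3 * c / Real.log t ^ 4) volume t x ∧
    ∫ t in t..x, (a / Real.log t ^ 2 + (c - 2 * a) / Real.log t ^ 3 - 3 * c / Real.log t ^ 4) =
      (a * (x / Real.log x ^ 2) + c * (x / Real.log x ^ 3)) -
      (a * (t / Real.log t ^ 2) + c * (t / Real.log t ^ 3)) := by
  have hgt : ∀ y ∈ Set.uIcc t x, 1 < y := fun y hy ↦ by
    rw [Set.uIcc_of_le hx] at hy
    exact ht.trans_le hy.1
  have hi : IntervalIntegrable (fun t ↦ a / Real.log t ^ 2 + (c - 2 * a) / Real.log t ^ 3 -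
      3 * c / Real.log t ^ 4) volume t x := by
    refine ContinuousOn.intervalIntegrable fun y hy ↦ ContinuousAt.continuousWithinAt ?_
    have h1 := hgt y hy
    have h0 : y ≠ 0 := by linarith
    have hL : Real.log y ≠ 0 := (Real.log_pos h1).ne'
    fun_prop (disch := first | assumption | positivity)
  exact ⟨hi, intervalIntegral.integral_eq_sub_of_hasDerivAt
    (fun y hy ↦ hasDerivAt_mul_div_log_pow a c (hgt y hy)) hi⟩

lemma eventually_div_log_sub_one_add_one_le_primeCounting : ∀ᶠ x : ℝ in atTop,
    x / (Real.log x - 1) + 1 ≤ Nat.primeCounting ⌊x⌋₊ := by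
  have hθ := eventually_abs_theta_sub_le (ε := 1 / 4) (by norm_num)
  obtain ⟨t₀, ht₀⟩ := eventually_atTop.mp
    (hθ.and (Real.tendsto_log_atTop.eventually_ge_atTop 1))
  set t := max t₀ 2 with ht
  have ht2 : 2 ≤ t := le_max_right _ _
  set C := 1 * (t / Real.log t ^ 2) + 3 / 2 * (t / Real.log t ^ 3) with hC
  have hCt : 0 ≤ C := by
    have := Real.log_nonneg (by linarith : 1 ≤ t)
    positivity
  filter_upwards [eventually_ge_atTop t, Real.tendsto_log_atTop.eventually_ge_atTop 10,
    eventually_log_pow_le (by positivity : 0 < 1 / (8 * (C + 1))) 3] with x hx hL hx3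
  have hx2 : 2 ≤ x := ht2.trans hx
  rw [Chebyshev.primeCounting_eq_theta_div_log_add_integral hx2,
    ← intervalIntegral.integral_add_adjacent_intervals
      (intervalIntegrable_theta_div le_rfl ht2) (intervalIntegrable_theta_div ht2 hx)]
  have h1 : 0 ≤ ∫ y in 2..t, θ y / (y * Real.log y ^ 2) := by
    refine intervalIntegral.integral_nonneg ht2 fun y hy ↦ ?_
    have hy0 : 0 ≤ y := by linarith [hy.1]
    have := Chebyshev.theta_nonneg y
    positivity
  obtain ⟨hi, h2⟩ := integral_deriv_mul_div_log_pow 1 (3 / 2) (by linarith : 1 < t) hx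
  have h3 := intervalIntegral.integral_mono_on hx hi (intervalIntegrable_theta_div ht2 hx)
    (fun y hy ↦ by
      obtain ⟨g1, g2⟩ := ht₀ y ((le_max_left _ _).trans hy.1)
      have hy0 : 0 < y := by linarith [hy.1]
      have g3 := (abs_le.mp g1).1
      have hl : 0 < Real.log y := by linarith
      have g4 : 1 / Real.log y ^ 2 + (3 / 2 - 2 * 1) / Real.log y ^ 3 -
          3 * (3 / 2) / Real.log y ^ 4 ≤
          (y - 1 / 4 * (y / Real.log y ^ 2)) / (y * Real.log y ^ 2) := by
        rw [← sub_nonneg]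
        have : (y - 1 / 4 * (y / Real.log y ^ 2)) / (y * Real.log y ^ 2) -
            (1 / Real.log y ^ 2 + (3 / 2 - 2 * 1) / Real.log y ^ 3 -
              3 * (3 / 2) / Real.log y ^ 4) =
            (1 / 2 * Real.log y + 17 / 4) / Real.log y ^ 4 := by
          field_simp
          ring
        rw [this]
        positivity
      refine g4.trans ?_
      gcongr
      linarith)
  rw [h2] at h3
  have h4 := (abs_le.mp (ht₀ x ((le_max_left _ _).trans hx)).1).1
  set L := Real.log x
  have hL0 : 0 < L := by linarith
  have h5 : x / L - 1 / 4 * (x / L ^ 3) ≤ θ x / L := by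
    rw [le_div_iff₀ hL0]
    have : (x / L - 1 / 4 * (x / L ^ 3)) * L = x - 1 / 4 * (x / L ^ 2) := by field_simp
    linarith
  have h6 : C + 1 ≤ 1 / 8 * (x / L ^ 3) := by
    rw [← mul_div_assoc, le_div_iff₀ (by positivity)]
    calc (C + 1) * L ^ 3 ≤ (C + 1) * (1 / (8 * (C + 1)) * x) := by gcongr
      _ = 1 / 8 * x := by field_simp
  have h7 : x / (L - 1) ≤ x / L + x / L ^ 2 + 9 / 8 * (x / L ^ 3) := by
    rw [div_le_iff₀ (by linarith), ← sub_nonneg]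
    have : (x / L + x / L ^ 2 + 9 / 8 * (x / L ^ 3)) * (L - 1) - x =
        x * (1 / 8 * L - 9 / 8) / L ^ 3 := by
      field_simp
      ring
    rw [this]
    have : 0 ≤ 1 / 8 * L - 9 / 8 := by linarith
    positivity
  linarith

lemma eventually_primeCounting_add_one_le_div_log_sub_two : ∀ᶠ x : ℝ in atTop,
    (Nat.primeCounting ⌊x⌋₊ : ℝ) + 1 ≤ x / (Real.log x - 2) := by
  have hθ := eventually_abs_theta_sub_le (ε := 1 / 4) (by norm_num)
  obtain ⟨t₀, ht₀⟩ := eventually_atTop.mp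
    (hθ.and (Real.tendsto_log_atTop.eventually_ge_atTop 10))
  set t := max t₀ 2 with ht
  have ht2 : 2 ≤ t := le_max_right _ _
  set C := ∫ y in 2..t, θ y / (y * Real.log y ^ 2) with hC
  have hCt : 0 ≤ C := by
    refine intervalIntegral.integral_nonneg ht2 fun y hy ↦ ?_
    have hy0 : 0 ≤ y := by linarith [hy.1]
    have := Chebyshev.theta_nonneg y
    positivity
  filter_upwards [eventually_ge_atTop t, Real.tendsto_log_atTop.eventually_ge_atTop 10,
    eventually_log_pow_le (by positivity : 0 < 1 / (4 * (C + 1))) 2] with x hx hL hx3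
  have hx2 : 2 ≤ x := ht2.trans hx
  rw [Chebyshev.primeCounting_eq_theta_div_log_add_integral hx2,
    ← intervalIntegral.integral_add_adjacent_intervals
      (intervalIntegrable_theta_div le_rfl ht2) (intervalIntegrable_theta_div ht2 hx)]
  obtain ⟨hi, h2⟩ := integral_deriv_mul_div_log_pow (3 / 2) 0 (by linarith : 1 < t) hx
  have h3 := intervalIntegral.integral_mono_on hx (intervalIntegrable_theta_div ht2 hx) hi
    (fun y hy ↦ by
      obtain ⟨g1, g2⟩ := ht₀ y ((le_max_left _ _).trans hy.1)
      have hy0 : 0 < y := by linarith [hy.1]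
      have g3 := (abs_le.mp g1).2
      have hl : 0 < Real.log y := by linarith
      have g4 : (y + 1 / 4 * (y / Real.log y ^ 2)) / (y * Real.log y ^ 2) ≤
          3 / 2 / Real.log y ^ 2 + (0 - 2 * (3 / 2)) / Real.log y ^ 3 -
          3 * 0 / Real.log y ^ 4 := by
        rw [← sub_nonneg]
        have : 3 / 2 / Real.log y ^ 2 + (0 - 2 * (3 / 2)) / Real.log y ^ 3 -
            3 * 0 / Real.log y ^ 4 -
            (y + 1 / 4 * (y / Real.log y ^ 2)) / (y * Real.log y ^ 2) =
            (1 / 2 * Real.log y ^ 2 - 3 * Real.log y - 1 / 4) / Real.log y ^ 4 := by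
          field_simp
          ring
        rw [this]
        have : 0 ≤ 1 / 2 * Real.log y ^ 2 - 3 * Real.log y - 1 / 4 := by nlinarith
        positivity
      refine le_trans ?_ g4
      gcongr
      linarith)
  rw [h2] at h3
  have h8 : 0 ≤ 3 / 2 * (t / Real.log t ^ 2) + 0 * (t / Real.log t ^ 3) := by
    have := Real.log_nonneg (by linarith : 1 ≤ t)
    positivity
  have h4 := (abs_le.mp (ht₀ x ((le_max_left _ _).trans hx)).1).2
  set L := Real.log x
  have hL0 : 0 < L := by linarith
  have h5 : θ x / L ≤ x / L + 1 / 4 * (x / L ^ 2) := by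
    rw [div_le_iff₀ hL0]
    have h9 : (x / L + 1 / 4 * (x / L ^ 2)) * L = x + 1 / 4 * (x / L ^ 2) * L := by field_simp
    have h10 : 1 / 4 * (x / L ^ 2) * 1 ≤ 1 / 4 * (x / L ^ 2) * L := by gcongr; linarith
    linarith
  have h6 : C + 1 ≤ 1 / 4 * (x / L ^ 2) := by
    rw [← mul_div_assoc, le_div_iff₀ (by positivity)]
    calc (C + 1) * L ^ 2 ≤ (C + 1) * (1 / (4 * (C + 1)) * x) := by gcongr
      _ = 1 / 4 * x := by field_simp
  have h7 : x / L + 2 * (x / L ^ 2) ≤ x / (L - 2) := by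
    rw [le_div_iff₀ (by linarith), ← sub_nonneg]
    have : x - (x / L + 2 * (x / L ^ 2)) * (L - 2) = 4 * x / L ^ 2 := by
      field_simp
      ring
    rw [this]
    positivity
  linarith

lemma Int.exists_eq_zero_of_succ_le_add_one {f : ℕ → ℤ} (hf : ∀ n, f (n + 1) ≤ f n + 1) {a b : ℕ}
    (hab : a ≤ b) (ha : f a ≤ 0) (hb : 0 ≤ f b) : ∃ n, a ≤ n ∧ n ≤ b ∧ f n = 0 := by
  induction b, hab using Nat.le_induction with
  | base => exact ⟨a, le_rfl, le_rfl, le_antisymm ha hb⟩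
  | succ m ham ih =>
    rcases le_or_gt 0 (f m) with h | h
    · obtain ⟨n, h1, h2, h3⟩ := ih h
      exact ⟨n, h1, h2.trans m.le_succ, h3⟩
    · exact ⟨m + 1, ham.trans m.le_succ, le_rfl, le_antisymm ((hf m).trans (by lia)) hb⟩

lemma eventually_exists_eq_mul_primeCounting : ∀ᶠ k : ℕ in atTop, ∃ n : ℕ,
    Real.exp (k + 1) ≤ n ∧ (n : ℝ) < Real.exp (k + 2) ∧ n = k * Nat.primeCounting n := by
  have hlim : ∀ c : ℝ, Tendsto (fun k : ℕ ↦ Real.exp (k + c)) atTop atTop := fun c ↦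
    Real.tendsto_exp_atTop.comp (tendsto_atTop_add_const_right _ _ tendsto_natCast_atTop_atTop)
  filter_upwards [(hlim 1).eventually eventually_div_log_sub_one_add_one_le_primeCounting,
    (hlim 2).eventually eventually_primeCounting_add_one_le_div_log_sub_two,
    eventually_ge_atTop 1] with k h1 h2 hk
  have hk0 : (0 : ℝ) < k := by exact_mod_cast hk
  have hk1 : (1 : ℝ) ≤ k := by exact_mod_cast hk
  rw [Real.log_exp, add_sub_cancel_right] at h1 h2
  set x := Real.exp (k + 1) with hx
  set z := Real.exp (k + 2) with hz
  have hx0 : 0 < x := Real.exp_pos _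
  have hxz : 2 * x ≤ z := by
    have : z = Real.exp 1 * x := by rw [hz, hx, ← Real.exp_add]; ring_nf
    rw [this]
    gcongr
    linarith [Real.exp_one_gt_d9]
  have hx1 : 1 ≤ x := Real.one_le_exp (by linarith)
  set a := ⌈x⌉₊
  set b := ⌈z⌉₊ - 1
  have hza : 0 < ⌈z⌉₊ := Nat.ceil_pos.mpr (by linarith)
  have hb : (b : ℝ) + 1 = ⌈z⌉₊ := by exact_mod_cast Nat.succ_pred_eq_of_pos hza
  have ha1 : x ≤ a := Nat.le_ceil x
  have ha2 : (a : ℝ) < x + 1 := Nat.ceil_lt_add_one hx0.le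
  have hb1 : z ≤ b + 1 := hb ▸ Nat.le_ceil z
  have hb2 : (b : ℝ) < z := by
    have := Nat.ceil_lt_add_one (hx0.le.trans (by linarith : x ≤ z))
    linarith
  have hab : a ≤ b := by
    have : (a : ℝ) < b + 1 := by linarith
    exact Nat.lt_succ_iff.mp (by exact_mod_cast this)
  have hπa : (Nat.primeCounting ⌊x⌋₊ : ℝ) ≤ Nat.primeCounting a := by
    exact_mod_cast Nat.monotone_primeCounting (Nat.floor_le_ceil x)
  have hπb : (Nat.primeCounting b : ℝ) ≤ Nat.primeCounting ⌊z⌋₊ := by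
    exact_mod_cast Nat.monotone_primeCounting (Nat.le_floor hb2.le)
  have hfa : ((a : ℤ) - k * Nat.primeCounting a : ℤ) ≤ 0 := by
    have : (a : ℝ) - k * Nat.primeCounting a ≤ 0 := by
      have : (k : ℝ) * (x / k + 1) ≤ k * Nat.primeCounting a := by gcongr; exact h1.trans hπa
      rw [mul_add, mul_div_cancel₀ _ hk0.ne'] at this
      linarith
    exact_mod_cast this
  have hfb : 0 ≤ ((b : ℤ) - k * Nat.primeCounting b : ℤ) := by
    have : 0 ≤ (b : ℝ) - k * Nat.primeCounting b := by
      have : (k : ℝ) * (Nat.primeCounting b + 1) ≤ k * (z / k) := by gcongr; linarith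
      rw [mul_add, mul_div_cancel₀ _ hk0.ne'] at this
      linarith
    exact_mod_cast this
  obtain ⟨n, g1, g2, g3⟩ := Int.exists_eq_zero_of_succ_le_add_one
    (f := fun n ↦ (n : ℤ) - k * Nat.primeCounting n) (fun n ↦ by
      have : (k : ℤ) * Nat.primeCounting n ≤ k * Nat.primeCounting (n + 1) := by
        exact_mod_cast Nat.mul_le_mul_left k (Nat.monotone_primeCounting n.le_succ)
      push_cast
      linarith) hab hfa hfb
  refine ⟨n, ha1.trans (by exact_mod_cast g1), lt_of_le_of_lt (by exact_mod_cast g2) hb2, ?_⟩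
  zify
  exact sub_eq_zero.mp g3

end PrimeNumberTheorem

/-- There are infinitely many positive integers `n` such that
`π(n) = n / ⌊log n − 1⌋`, i.e. `⌊log n − 1⌋` is positive, divides `n`,
and the quotient `n / ⌊log n − 1⌋` equals `π(n)`. -/
theorem stmt0 :
    {n : ℕ | 0 < n ∧ 0 < ⌊Real.log n - 1⌋ ∧ ⌊Real.log n - 1⌋ ∣ (n : ℤ) ∧
      (n : ℤ) / ⌊Real.log n - 1⌋ = Nat.primeCounting n}.Infinite := by
  rw [Set.infinite_iff_exists_gt]
  intro N
  obtain ⟨k, ⟨n, h1, h2, h3⟩, hk⟩ := (eventually_exists_eq_mul_primeCounting.and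
    (Filter.eventually_ge_atTop (N + 1))).exists
  have hn0 : (0 : ℝ) < n := (Real.exp_pos _).trans_le h1
  have hfl : ⌊Real.log n - 1⌋ = k := by
    rw [Int.floor_eq_iff]
    have g1 := (Real.le_log_iff_exp_le hn0).mpr h1
    have g2 := (Real.log_lt_iff_lt_exp hn0).mpr h2
    push_cast
    constructor <;> linarith
  have hk0 : (0 : ℤ) < k := by lia
  have h3' : (n : ℤ) = k * Nat.primeCounting n := by exact_mod_cast h3
  refine ⟨n, ?_, ?_⟩
  · simp only [Set.mem_ofPred_eq]
    rw [hfl]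
    exact ⟨by exact_mod_cast hn0, hk0, ⟨_, h3'⟩, Int.ediv_eq_of_eq_mul_right hk0.ne' h3'⟩
  · have g : (N : ℝ) + 1 ≤ k := by exact_mod_cast hk
    have : (N : ℝ) < n := by linarith [Real.add_one_le_exp ((k : ℝ) + 1)]
    exact_mod_cast this
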